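/- For every δ > 0 and every L ∈ ℕ there exist constants ε₀ = ε₀(δ, L) > 0 and n₀ ∈ ℕ such that for every 0 < ε < ε₀ the following holds. Let G be a (p,λ)-bijumbled graph on n ≥ n₀ vertices with p ∈ (0, 1/2], λ ≤ ε p² n, and minimum degree δ(G) ≥ δ p n. Then for any integers ℓ₁, …, ℓ_t with 4 ≤ ℓᵢ ≤ L for each i and ℓ₁ + ⋯ + ℓ_t ≤ n, the graph G contains t vertex-disjoint cycles of lengths ℓ₁, …, ℓ_t. -/

import Mathlib

open Finset

/-- The number of pairs `(a,b) ∈ A × B` with `ab` an edge of `G`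
(edges inside `A ∩ B` are counted twice). -/
def ePairs {V : Type} [DecidableEq V] (G : SimpleGraph V) [DecidableRel G.Adj]
    (A B : Finset V) : ℕ :=
  ((A ×ˢ B).filter fun ab => G.Adj ab.1 ab.2).card

/-- `G` is `(p,λ)`-bijumbled: `|e(A,B) − p|A||B|| < λ√(|A||B|)` for all (nonempty)
vertex subsets `A, B`. -/
def Bijumbled {V : Type} [Fintype V] [DecidableEq V] (G : SimpleGraph V)
    [DecidableRel G.Adj] (p lam : ℝ) : Prop :=
  ∀ A B : Finset V, A.Nonempty → B.Nonempty →
    |(ePairs G A B : ℝ) - p * A.card * B.card| < lam * Real.sqrt (A.card * B.card)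

/-- `φ` picks, for every index in `I`, a member of its family, pairwise disjointly. -/
def IsDisjointChoice {ι V : Type*} [DecidableEq V] (𝓕 : ι → Finset V → Prop) (I : Finset ι)
    (φ : ι → Finset V) : Prop :=
  (∀ i ∈ I, 𝓕 i (φ i)) ∧ ∀ i ∈ I, ∀ j ∈ I, i ≠ j → Disjoint (φ i) (φ j)

/-- The augmentation step in Haxell's theorem. -/
theorem IsDisjointChoice.exists_augment {ι V : Type*} [DecidableEq ι] [DecidableEq V]
    {𝓕 : ι → Finset V → Prop} {r : ℕ} (hr : ∀ i F, 𝓕 i F → #F ≤ r)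
    (H : ∀ J : Finset ι, J.Nonempty → ∀ Q : Finset V, #Q ≤ 2 * r * #J →
      ∃ i ∈ J, ∃ F, 𝓕 i F ∧ Disjoint F Q) (I : Finset ι) :
    ∀ N : ℕ, ∀ J : Finset ι, J.Nonempty → #(I \ J) < N → ∀ Q : Finset V, #Q ≤ 2 * r * #J →
      ∀ φ : ι → Finset V, IsDisjointChoice 𝓕 I φ → (∀ j ∈ J, j ∈ I → φ j ⊆ Q) →
      ∃ φ', IsDisjointChoice 𝓕 I φ' ∧ (∀ j ∈ J, φ' j = φ j) ∧
        (∀ j ∈ I, φ' j = φ j ∨ Disjoint (φ' j) Q) ∧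
        ∃ i ∈ J, ∃ E, 𝓕 i E ∧ Disjoint E Q ∧ ∀ b ∈ I, Disjoint E (φ' b) := by
  intro N
  induction N with
  | zero => intro J _ h; omega
  | succ N ih =>
    intro J hJ hN Q hQ φ hφ hφQ
    suffices key : ∀ c : ℕ, ∀ φ', IsDisjointChoice 𝓕 I φ' → (∀ j ∈ J, φ' j = φ j) →
        (∀ j ∈ I, φ' j = φ j ∨ Disjoint (φ' j) Q) → ∀ i ∈ J, ∀ E, 𝓕 i E → Disjoint E Q →
        #(I.filter fun b => ¬ Disjoint E (φ' b)) ≤ c →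
        ∃ φ', IsDisjointChoice 𝓕 I φ' ∧ (∀ j ∈ J, φ' j = φ j) ∧
        (∀ j ∈ I, φ' j = φ j ∨ Disjoint (φ' j) Q) ∧
        ∃ i ∈ J, ∃ E, 𝓕 i E ∧ Disjoint E Q ∧ ∀ b ∈ I, Disjoint E (φ' b) by
      obtain ⟨i, hi, E, hE, hEQ⟩ := H J hJ Q hQ
      exact key _ φ hφ (fun _ _ => rfl) (fun _ _ => Or.inl rfl) i hi E hE hEQ le_rfl
    intro c
    induction c with
    | zero =>
      intro φ' h1 h2 h3 i hi E hE hEQ hc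
      refine ⟨φ', h1, h2, h3, i, hi, E, hE, hEQ, fun b hb => ?_⟩
      by_contra hcon
      have : b ∈ (I.filter fun b => ¬ Disjoint E (φ' b)) := by simp [hb, hcon]
      have := Finset.card_pos.mpr ⟨b, this⟩
      omega
    | succ c ihc =>
      intro φ' h1 h2 h3 i hi E hE hEQ hc
      set B := I.filter fun b => ¬ Disjoint E (φ' b) with hB
      by_cases hBe : B = ∅
      · exact ihc φ' h1 h2 h3 i hi E hE hEQ (by rw [← hB, hBe]; simp)
      have hBne : B.Nonempty := Finset.nonempty_iff_ne_empty.mpr hBe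
      have hBJ : Disjoint J B := by
        rw [Finset.disjoint_right]
        intro b hb hbJ
        rw [hB, Finset.mem_filter] at hb
        apply hb.2
        rw [h2 b hbJ]
        exact hEQ.mono_right (hφQ b hbJ hb.1)
      have hBI : B ⊆ I := Finset.filter_subset _ _
      have hlt : #(I \ (J ∪ B)) < #(I \ J) := by
        apply Finset.card_lt_card
        rw [Finset.ssubset_iff_of_subset (Finset.sdiff_subset_sdiff le_rfl subset_union_left)]
        obtain ⟨b, hb⟩ := hBne
        refine ⟨b, ?_, ?_⟩
        · simp only [mem_sdiff]; exact ⟨hBI hb, Finset.disjoint_right.mp hBJ hb⟩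
        · simp [hb]
      obtain ⟨ψ, k1, k2, k3, i', hi', E', hE', hE'Q, hE'I⟩ :=
        ih (J ∪ B) (hJ.mono subset_union_left) (by omega) (Q ∪ E ∪ B.biUnion φ') (by
          rw [Finset.card_union_of_disjoint hBJ]
          have a1 := Finset.card_union_le (Q ∪ E) (B.biUnion φ')
          have a2 := Finset.card_union_le Q E
          have a3 : #(B.biUnion φ') ≤ #B * r :=
            Finset.card_biUnion_le_card_mul _ _ _ fun b hb => hr b _ (h1.1 b (hBI hb))
          have a4 := hr _ _ hE
          have a5 := hBne.card_pos
          nlinarith) φ' h1 (by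
          intro j hj hjI
          rcases Finset.mem_union.mp hj with hj | hj
          · rw [h2 j hj]
            exact (hφQ j hj hjI).trans (subset_union_left.trans subset_union_left)
          · exact (Finset.subset_biUnion_of_mem φ' hj).trans subset_union_right)
      have hsub : Q ⊆ Q ∪ E ∪ B.biUnion φ' := subset_union_left.trans subset_union_left
      have hsubE : E ⊆ Q ∪ E ∪ B.biUnion φ' := subset_union_right.trans subset_union_left
      have m3 : ∀ j ∈ I, ψ j = φ j ∨ Disjoint (ψ j) Q := by
        intro j hj
        rcases k3 j hj with h | h
        · rw [h]; exact h3 j hj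
        · exact Or.inr (h.mono_right hsub)
      rcases Finset.mem_union.mp hi' with hJ' | hB'
      · exact ⟨ψ, k1, fun j hj => (k2 j (mem_union_left _ hj)).trans (h2 j hj), m3, i', hJ', E',
          hE', hE'Q.mono_right hsub, hE'I⟩
      · refine ihc (Function.update ψ i' E') ⟨?_, ?_⟩ ?_ ?_ i hi E hE hEQ ?_
        · intro j hj
          by_cases hji : j = i'
          · subst hji; simpa using hE'
          · simpa [hji] using k1.1 j hj
        · intro j hj j' hj' hne
          by_cases hji : j = i'
          · subst hji
            simpa [Function.update_of_ne hne.symm] using hE'I j' hj'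
          · by_cases hji' : j' = i'
            · subst hji'
              simpa [Function.update_of_ne hji] using (hE'I j hj).symm
            · simpa [hji, hji'] using k1.2 j hj j' hj' hne
        · intro j hj
          have : j ≠ i' := fun h => Finset.disjoint_right.mp hBJ hB' (h ▸ hj)
          rw [Function.update_of_ne this]
          exact (k2 j (mem_union_left _ hj)).trans (h2 j hj)
        · intro j hj
          by_cases hji : j = i'
          · subst hji; right; simpa using hE'Q.mono_right hsub
          · simpa [hji] using m3 j hj
        · have : (I.filter fun b => ¬ Disjoint E (Function.update ψ i' E' b)) ⊆ B.erase i' := by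
            intro b hb
            rw [Finset.mem_filter] at hb
            have hbi : b ≠ i' := by
              rintro rfl
              apply hb.2
              simpa using (hE'Q.mono_right hsubE).symm
            rw [Function.update_of_ne hbi] at hb
            rw [Finset.mem_erase]
            refine ⟨hbi, ?_⟩
            rw [hB, Finset.mem_filter]
            refine ⟨hb.1, ?_⟩
            rcases k3 b hb.1 with h | h
            · rw [← h]; exact hb.2
            · exact absurd (h.mono_right hsubE).symm hb.2
          have := Finset.card_le_card this
          rw [Finset.card_erase_of_mem hB'] at this
          omega

/-- A form of **Haxell's theorem**: if no set of at most `2 r |J|` points meets all members of all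
families indexed by `J`, for every nonempty `J`, then there is a system of disjoint
representatives. -/
theorem exists_disjointChoice {ι V : Type*} [Fintype ι] [DecidableEq ι] [DecidableEq V]
    {𝓕 : ι → Finset V → Prop} {r : ℕ} (hr : ∀ i F, 𝓕 i F → #F ≤ r)
    (H : ∀ J : Finset ι, J.Nonempty → ∀ Q : Finset V, #Q ≤ 2 * r * #J →
      ∃ i ∈ J, ∃ F, 𝓕 i F ∧ Disjoint F Q) :
    ∃ φ : ι → Finset V, (∀ i, 𝓕 i (φ i)) ∧ ∀ i j, i ≠ j → Disjoint (φ i) (φ j) := by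
  suffices h : ∀ I : Finset ι, ∃ φ, IsDisjointChoice 𝓕 I φ by
    obtain ⟨φ, h1, h2⟩ := h univ
    exact ⟨φ, fun i => h1 i (mem_univ _), fun i j => h2 i (mem_univ _) j (mem_univ _)⟩
  intro I
  induction I using Finset.induction_on with
  | empty => exact ⟨fun _ => ∅, by simp [IsDisjointChoice]⟩
  | insert a I ha ih =>
    obtain ⟨φ, hφ⟩ := ih
    obtain ⟨ψ, k1, -, -, i, hi, E, hE, -, hEI⟩ := IsDisjointChoice.exists_augment hr H I _ {a}
      (by simp) (Nat.lt_succ_self _) ∅ (by simp) φ hφ (by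
        intro j hj hjI
        rw [Finset.mem_singleton] at hj
        exact absurd (hj ▸ hjI) ha)
    rw [Finset.mem_singleton] at hi
    subst hi
    refine ⟨Function.update ψ i E, ?_, ?_⟩
    · intro j hj
      by_cases hji : j = i
      · subst hji; simpa using hE
      · simpa [hji] using k1.1 j ((mem_insert.mp hj).resolve_left hji)
    · intro j hj j' hj' hne
      by_cases hji : j = i
      · subst hji
        simpa [Function.update_of_ne hne.symm] using
          hEI j' ((mem_insert.mp hj').resolve_left hne.symm)
      · by_cases hji' : j' = i
        · subst hji'
          simpa [Function.update_of_ne hji] using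
            (hEI j ((mem_insert.mp hj).resolve_left hji)).symm
        · simpa [hji, hji'] using k1.2 j ((mem_insert.mp hj).resolve_left hji) j'
            ((mem_insert.mp hj').resolve_left hji') hne

theorem Equiv.Perm.exists_image_eq {α : Type*} [Fintype α] [DecidableEq α] {A B : Finset α}
    (h : #A = #B) : ∃ τ : Equiv.Perm α, A.image τ = B := by
  have e : {x // x ∈ A} ≃ {x // x ∈ B} := Fintype.equivOfCardEq (by simpa using h)
  refine ⟨e.extendSubtype, ?_⟩
  apply Finset.eq_of_subset_of_card_le
  · intro x hx
    obtain ⟨a, ha, rfl⟩ := Finset.mem_image.mp hx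
    exact e.extendSubtype_mem a ha
  · rw [Finset.card_image_of_injective _ (Equiv.injective _), h]

theorem Equiv.Perm.card_image_eq_mul_choose {α : Type*} [Fintype α] [DecidableEq α]
    {A B : Finset α} (h : #A = #B) :
    #{σ : Equiv.Perm α | A.image σ = B} * (Fintype.card α).choose #A =
      (Fintype.card α).factorial := by
  have hfib : ∀ C ∈ powersetCard #A (univ : Finset α),
      #{σ : Equiv.Perm α | A.image σ = C} = #{σ : Equiv.Perm α | A.image σ = B} := by
    intro C hC
    rw [Finset.mem_powersetCard] at hC
    obtain ⟨τ, hτ⟩ := Equiv.Perm.exists_image_eq (hC.2.trans h)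
    apply Finset.card_bij' (fun σ _ => τ * σ) (fun σ _ => τ⁻¹ * σ)
    · intro σ hσ
      simp only [mem_filter, mem_univ, true_and] at hσ ⊢
      rw [Equiv.Perm.coe_mul, ← Finset.image_image, hσ, hτ]
    · intro σ hσ
      simp only [mem_filter, mem_univ, true_and] at hσ ⊢
      rw [Equiv.Perm.coe_mul, ← Finset.image_image, hσ, ← hτ, Finset.image_image]
      simp
    · intro σ _; simp
    · intro σ _; simp
  have hsum : #(univ : Finset (Equiv.Perm α)) =
      ∑ C ∈ powersetCard #A (univ : Finset α), #{σ : Equiv.Perm α | A.image σ = C} := by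
    apply Finset.card_eq_sum_card_fiberwise
    intro σ _
    simp [Finset.mem_powersetCard, Finset.card_image_of_injective _ σ.injective]
  rw [Finset.sum_congr rfl hfib, Finset.sum_const, Finset.card_powersetCard, Finset.card_univ,
    Fintype.card_perm, Finset.card_univ, smul_eq_mul] at hsum
  rw [hsum, mul_comm]

theorem Equiv.Perm.card_image_subset_mul_choose {α : Type*} [Fintype α] [DecidableEq α]
    (A T : Finset α) :
    #{σ : Equiv.Perm α | A.image σ ⊆ T} * (Fintype.card α).choose #A =
      (Fintype.card α).factorial * (#T).choose #A := by
  have hsum : #{σ : Equiv.Perm α | A.image σ ⊆ T} =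
      ∑ C ∈ powersetCard #A T, #{σ : Equiv.Perm α | A.image σ = C} := by
    rw [Finset.card_eq_sum_card_fiberwise (f := fun σ : Equiv.Perm α => A.image σ)
      (t := powersetCard #A T)]
    · apply Finset.sum_congr rfl
      intro C hC
      rw [Finset.mem_powersetCard] at hC
      congr 1
      ext σ
      simp only [mem_filter, mem_univ, true_and]
      exact ⟨fun h => h.2, fun h => ⟨h ▸ hC.1, h⟩⟩
    · intro σ hσ
      simp only [coe_filter, mem_univ, true_and, Set.mem_ofPred_eq] at hσ
      simp [Finset.mem_powersetCard, Finset.card_image_of_injective _ σ.injective, hσ]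
  have hterm : ∀ C ∈ powersetCard #A T,
      #{σ : Equiv.Perm α | A.image σ = C} * (Fintype.card α).choose #A =
        (Fintype.card α).factorial := fun C hC =>
    Equiv.Perm.card_image_eq_mul_choose (Finset.mem_powersetCard.mp hC).2.symm
  rw [hsum, Finset.sum_mul, Finset.sum_congr rfl hterm, Finset.sum_const,
    Finset.card_powersetCard, smul_eq_mul, mul_comm]

theorem Nat.sixteen_pow_le_choose {N a : ℕ} (h : 16 * a ≤ N) : 16 ^ a ≤ N.choose a := by
  induction a generalizing N with
  | zero => simp
  | succ a ih =>
    obtain ⟨M, rfl⟩ : ∃ M, N = M + 1 := ⟨N - 1, by omega⟩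
    have h1 := ih (N := M) (by omega)
    have h2 := Nat.add_one_mul_choose_eq M a
    have h3 : 16 * (a + 1) * M.choose a ≤ (M + 1).choose (a + 1) * (a + 1) := by
      rw [← h2]; exact Nat.mul_le_mul_right _ h
    have h4 : 16 * M.choose a ≤ (M + 1).choose (a + 1) := by
      refine Nat.le_of_mul_le_mul_right (c := a + 1) ?_ (by omega)
      calc _ = 16 * (a + 1) * M.choose a := by ring
        _ ≤ _ := h3
    calc 16 ^ (a + 1) = 16 * 16 ^ a := by ring
      _ ≤ 16 * M.choose a := by omega
      _ ≤ _ := h4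

theorem Nat.choose_mul_pow_le {t N : ℕ} (h : t ≤ N) (a : ℕ) :
    t.choose a * N ^ a ≤ N.choose a * t ^ a := by
  induction a with
  | zero => simp
  | succ a ih =>
    refine Nat.le_of_mul_le_mul_right (c := a + 1) ?_ (by omega)
    have h1 := Nat.choose_succ_right_eq t a
    have h2 := Nat.choose_succ_right_eq N a
    have h3 : (t - a) * N ≤ (N - a) * t := by
      rw [Nat.sub_mul, Nat.sub_mul, mul_comm t N]
      exact Nat.sub_le_sub_left (Nat.mul_le_mul_left _ h) _
    calc t.choose (a + 1) * N ^ (a + 1) * (a + 1)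
        = (t.choose (a + 1) * (a + 1)) * N ^ a * N := by ring
      _ = (t.choose a * N ^ a) * ((t - a) * N) := by rw [h1]; ring
      _ ≤ (N.choose a * t ^ a) * ((N - a) * t) := Nat.mul_le_mul ih h3
      _ = (N.choose (a + 1) * (a + 1)) * t ^ a * t := by rw [h2]; ring
      _ = _ := by ring

theorem Nat.choose_two_mul_le_sq (N a : ℕ) :
    N.choose (2 * a) ≤ N.choose a ^ 2 := by
  have h1 := Nat.choose_mul (n := N) (k := 2 * a) (s := a) (show a ≤ 2 * a by omega)
  have h2 : (N - a).choose (2 * a - a) ≤ N.choose a := by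
    rw [show 2 * a - a = a by omega]
    exact Nat.choose_le_choose a (Nat.sub_le _ _)
  calc N.choose (2 * a) ≤ N.choose (2 * a) * (2 * a).choose a :=
        Nat.le_mul_of_pos_right _ (Nat.choose_pos (by omega))
    _ = N.choose a * (N - a).choose (2 * a - a) := h1
    _ ≤ N.choose a * N.choose a := Nat.mul_le_mul_left _ h2
    _ = _ := by ring

/-- The proportion of permutations mapping an `a`-set into a `t`-set, in an `N`-set. -/
noncomputable def chooseRatio (N t a : ℕ) : ℝ := (t.choose a : ℝ) / N.choose a

theorem card_perm_image_subset {N : ℕ} (A T : Finset (Fin N)) :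
    (#{σ : Equiv.Perm (Fin N) | A.image σ ⊆ T} : ℝ) = N.factorial * chooseRatio N #T #A := by
  have h := Equiv.Perm.card_image_subset_mul_choose A T
  rw [Fintype.card_fin] at h
  have hpos : (0 : ℝ) < N.choose #A := by
    exact_mod_cast Nat.choose_pos (by simpa using Finset.card_le_univ A)
  rw [chooseRatio, ← mul_div_assoc, eq_div_iff hpos.ne']
  exact_mod_cast h

theorem chooseRatio_nonneg (N t a : ℕ) : 0 ≤ chooseRatio N t a := by
  unfold chooseRatio; positivity

theorem choose_mul_chooseRatio_pow_le {N a D : ℕ} (ha : 16 * a ≤ N) (hD : 7 ≤ D) :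
    (N.choose (2 * a) : ℝ) * chooseRatio N (2 * a) a ^ D ≤ (1 / 4) ^ a / N.choose a := by
  set c : ℝ := (N.choose a : ℝ) with hc
  set q : ℝ := 4 ^ a with hq
  have hq1 : 1 ≤ q := one_le_pow₀ (by norm_num)
  have hqc : q ^ 2 ≤ c := by
    rw [hq, ← pow_mul, mul_comm, pow_mul, hc]
    norm_num
    exact_mod_cast Nat.sixteen_pow_le_choose ha
  have hc0 : 0 < c := by nlinarith
  have h2 : (N.choose (2 * a) : ℝ) ≤ c ^ 2 := by
    rw [hc]; exact_mod_cast Nat.choose_two_mul_le_sq N a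
  have h3 : chooseRatio N (2 * a) a ≤ q / c := by
    unfold chooseRatio
    rw [← hc]
    gcongr
    rw [hq]
    have : (2 * a).choose a ≤ 4 ^ a := by
      have := Nat.choose_le_two_pow (2 * a) a
      rwa [pow_mul] at this
    exact_mod_cast this
  have h4 : q / c ≤ 1 / q := by
    rw [div_le_div_iff₀ hc0 (by linarith)]; nlinarith
  have h5 : q / c ≤ 1 := h4.trans (by rw [div_le_one (by linarith)]; exact hq1)
  have hqc0 : 0 ≤ q / c := by positivity
  calc (N.choose (2 * a) : ℝ) * chooseRatio N (2 * a) a ^ D ≤ c ^ 2 * (q / c) ^ 7 := by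
        apply mul_le_mul h2 _ (pow_nonneg (chooseRatio_nonneg _ _ _) _) (by positivity)
        exact (pow_le_pow_left₀ (chooseRatio_nonneg _ _ _) h3 D).trans
          (pow_le_pow_of_le_one hqc0 h5 hD)
    _ = ((q ^ 2) ^ 3 / c ^ 3) * (q / c) / c := by field_simp
    _ ≤ 1 * (1 / q) / c := by
        gcongr
        rw [div_le_one (by positivity)]
        gcongr
    _ = _ := by rw [hq]; simp

theorem chooseRatio_pow_le {N t a : ℕ} (ha : N < 16 * a) (ht : 16 * t ≤ 15 * N) :
    chooseRatio N t a ^ 800 ≤ (1 / 16) ^ N := by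
  rcases Nat.lt_or_ge N a with h | h
  · unfold chooseRatio
    rw [Nat.choose_eq_zero_of_lt h]; simp
  have hN : 0 < N := by omega
  have h1 : chooseRatio N t a ≤ (15 / 16) ^ a := by
    have hpos : (0 : ℝ) < N.choose a := by exact_mod_cast Nat.choose_pos h
    have h := Nat.choose_mul_pow_le (show t ≤ N by omega) a
    have hN' : (0 : ℝ) < N := by exact_mod_cast hN
    have : chooseRatio N t a ≤ (t / N : ℝ) ^ a := by
      unfold chooseRatio
      rw [div_pow, div_le_div_iff₀ hpos (by positivity)]
      rw [mul_comm ((t : ℝ) ^ a)]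
      exact_mod_cast h
    refine this.trans (pow_le_pow_left₀ (by positivity) ?_ a)
    rw [div_le_div_iff₀ hN' (by norm_num)]
    have : (16 * t : ℝ) ≤ 15 * N := by exact_mod_cast ht
    linarith
  calc chooseRatio N t a ^ 800 ≤ ((15 / 16) ^ a) ^ 800 :=
        pow_le_pow_left₀ (chooseRatio_nonneg _ _ _) h1 _
    _ = (15 / 16) ^ (50 * (16 * a)) := by rw [← pow_mul]; congr 1; ring
    _ ≤ (15 / 16) ^ (50 * N) := by
        apply pow_le_pow_of_le_one (by norm_num) (by norm_num); omega
    _ = ((15 / 16) ^ 50) ^ N := by rw [pow_mul]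
    _ ≤ _ := by gcongr; norm_num

/-- Bounded-degree bipartite expanders, as unions of permutations. -/
theorem exists_perm_expander : ∃ D : ℕ, ∀ N : ℕ, ∃ σ : Fin D → Equiv.Perm (Fin N),
    ∀ A : Finset (Fin N),
      (16 * #A ≤ N → 2 * #A ≤ #(univ.biUnion fun j => A.image (σ j))) ∧
      (N < 16 * #A → 15 * N < 16 * #(univ.biUnion fun j => A.image (σ j))) := by
  refine ⟨800, fun N => ?_⟩
  by_contra! hcon
  rcases Nat.eq_zero_or_pos N with hN | hN
  · obtain ⟨A, hA⟩ := hcon fun _ => 1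
    have := Finset.card_le_univ A
    simp only [Fintype.card_fin] at this
    have h0 : #A = 0 := by omega
    have := hA (by simp [h0])
    omega
  set bad : Finset (Fin N) → Finset (Fin N) → Prop := fun A T =>
    (0 < #A ∧ 16 * #A ≤ N ∧ #T = 2 * #A) ∨ (N < 16 * #A ∧ 16 * #T ≤ 15 * N) with hbad
  classical
  have hcover : (univ : Finset (Fin 800 → Equiv.Perm (Fin N))) ⊆
      (univ.filter fun P : Finset (Fin N) × Finset (Fin N) => bad P.1 P.2).biUnion fun P =>
        Fintype.piFinset fun _ => {σ : Equiv.Perm (Fin N) | P.1.image σ ⊆ P.2} := by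
    intro σ _
    obtain ⟨A, hA⟩ := hcon σ
    set U := univ.biUnion fun j => A.image (σ j) with hU
    suffices h : ∃ T, bad A T ∧ U ⊆ T by
      obtain ⟨T, hT, hUT⟩ := h
      rw [Finset.mem_biUnion]
      refine ⟨(A, T), by simpa using hT, ?_⟩
      rw [Fintype.mem_piFinset]
      intro j
      simp only [mem_filter, mem_univ, true_and]
      exact (Finset.subset_biUnion_of_mem (fun j => A.image (σ j)) (mem_univ j)).trans hUT
    by_cases h1 : 16 * #A ≤ N ∧ #U < 2 * #A
    · obtain ⟨T, hT1, hT2⟩ := Finset.exists_superset_card_eq (s := U) (n := 2 * #A) h1.2.le (by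
        simp; omega)
      exact ⟨T, Or.inl ⟨by omega, h1.1, hT2⟩, hT1⟩
    · obtain ⟨h2, h3⟩ := hA (by intro h; by_contra h'; exact h1 ⟨h, by omega⟩)
      exact ⟨U, Or.inr ⟨h2, h3⟩, le_rfl⟩
  have hcard := (Finset.card_le_card hcover).trans Finset.card_biUnion_le
  have hfac : (0 : ℝ) < N.factorial := by exact_mod_cast Nat.factorial_pos N
  have hreal : ((N.factorial : ℝ)) ^ 800 ≤ ∑ P : Finset (Fin N) × Finset (Fin N),
      if bad P.1 P.2 then (N.factorial * chooseRatio N #P.2 #P.1) ^ 800 else 0 := by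
    have h := hcard
    rw [Finset.card_univ, Fintype.card_pi] at h
    simp only [Fintype.card_perm, Fintype.card_fin, Finset.prod_const, Finset.card_univ,
      Fintype.card_piFinset] at h
    rw [Finset.sum_filter] at h
    have h' : ((N.factorial : ℝ)) ^ 800 ≤ ((∑ P : Finset (Fin N) × Finset (Fin N),
      if bad P.1 P.2 then #{σ : Equiv.Perm (Fin N) | P.1.image σ ⊆ P.2} ^ 800 else 0 : ℕ) : ℝ) := by
      exact_mod_cast h
    refine h'.trans (le_of_eq ?_)
    push_cast
    refine Finset.sum_congr rfl fun P _ => ?_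
    split_ifs
    · rw [card_perm_image_subset]
    · rfl
  have hreal2 : (1 : ℝ) ≤ ∑ P : Finset (Fin N) × Finset (Fin N),
      if bad P.1 P.2 then chooseRatio N #P.2 #P.1 ^ 800 else 0 := by
    have : ∀ P : Finset (Fin N) × Finset (Fin N),
        (if bad P.1 P.2 then (N.factorial * chooseRatio N #P.2 #P.1) ^ 800 else 0) =
        (N.factorial : ℝ) ^ 800 * (if bad P.1 P.2 then chooseRatio N #P.2 #P.1 ^ 800 else 0) := by
      intro P; split_ifs
      · rw [mul_pow]
      · simp
    rw [Finset.sum_congr rfl fun P _ => this P, ← Finset.mul_sum] at hreal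
    exact le_of_mul_le_mul_left (by simpa using hreal) (pow_pos hfac 800)
  set f : ℕ → ℝ := fun a => if 0 < a ∧ 16 * a ≤ N then (1 / 4) ^ a / N.choose a else 0 with hf
  have hinner : ∀ A : Finset (Fin N),
      (∑ T : Finset (Fin N), if bad A T then chooseRatio N #T #A ^ 800 else 0) ≤
        f #A + (1 / 8) ^ N := by
    intro A
    by_cases hA : N < 16 * #A
    · have hfA : f #A = 0 := by simp only [hf]; rw [if_neg]; omega
      rw [hfA, zero_add]
      calc _ ≤ ∑ T : Finset (Fin N), (1 / 16 : ℝ) ^ N := by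
            apply Finset.sum_le_sum
            intro T _
            split_ifs with hb
            · rcases hb with hb | hb
              · omega
              · exact chooseRatio_pow_le hb.1 hb.2
            · positivity
        _ = (1 / 8) ^ N := by
            rw [Finset.sum_const, Finset.card_univ, Fintype.card_finset, Fintype.card_fin,
              nsmul_eq_mul]
            push_cast
            rw [← mul_pow]; norm_num
    · by_cases hA0 : 0 < #A
      · have hfA : f #A = (1 / 4) ^ #A / N.choose #A := by simp only [hf]; rw [if_pos]; omega
        have : (∑ T : Finset (Fin N), if bad A T then chooseRatio N #T #A ^ 800 else 0) =
            N.choose (2 * #A) * chooseRatio N (2 * #A) #A ^ 800 := by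
          rw [← Finset.sum_filter]
          have hset : (univ.filter fun T : Finset (Fin N) => bad A T) =
              powersetCard (2 * #A) univ := by
            ext T
            simp only [hbad, mem_filter, mem_univ, true_and, mem_powersetCard, subset_univ]
            omega
          rw [hset, Finset.sum_congr rfl fun T hT => by rw [(mem_powersetCard.mp hT).2],
            Finset.sum_const, Finset.card_powersetCard, Finset.card_univ, Fintype.card_fin,
            nsmul_eq_mul]
        rw [this, hfA]
        have := choose_mul_chooseRatio_pow_le (N := N) (a := #A) (D := 800) (by omega)
          (by norm_num)
        have h8 : (0 : ℝ) ≤ (1 / 8) ^ N := by positivity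
        linarith
      · have hz : (∑ T : Finset (Fin N), if bad A T then chooseRatio N #T #A ^ 800 else 0) = 0 := by
          apply Finset.sum_eq_zero
          intro T _
          rw [if_neg]
          simp only [hbad]
          omega
        have hfA : f #A = 0 := by simp only [hf]; rw [if_neg]; omega
        rw [hz, hfA]; positivity
  have htot : (1 : ℝ) ≤ ∑ A : Finset (Fin N), (f #A + (1 / 8) ^ N) := by
    refine hreal2.trans ?_
    rw [Fintype.sum_prod_type]
    exact Finset.sum_le_sum fun A _ => hinner A
  rw [Finset.sum_add_distrib, Finset.sum_const, Finset.card_univ, Fintype.card_finset,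
    Fintype.card_fin, nsmul_eq_mul] at htot
  have hsecond : ((2 ^ N : ℕ) : ℝ) * (1 / 8) ^ N ≤ 1 / 4 := by
    push_cast
    rw [← mul_pow]
    calc ((2 : ℝ) * (1 / 8)) ^ N ≤ (2 * (1 / 8)) ^ 1 :=
          pow_le_pow_of_le_one (by norm_num) (by norm_num) hN
      _ = 1 / 4 := by norm_num
  have hfirst : ∑ A : Finset (Fin N), f #A ≤ 1 / 3 := by
    have h := Finset.sum_powerset_apply_card (x := (univ : Finset (Fin N))) f
    rw [Finset.powerset_univ] at h
    rw [h, Finset.card_univ, Fintype.card_fin, Finset.sum_range_succ']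
    have h0 : f 0 = 0 := by simp [hf]
    rw [h0, smul_zero, add_zero]
    calc ∑ k ∈ range N, N.choose (k + 1) • f (k + 1) ≤ ∑ k ∈ range N, (1 / 4 : ℝ) ^ (k + 1) := by
          apply Finset.sum_le_sum
          intro k hk
          have hpos : (0 : ℝ) < N.choose (k + 1) := by
            exact_mod_cast Nat.choose_pos (by have := mem_range.mp hk; omega)
          simp only [hf]
          split_ifs
          · rw [nsmul_eq_mul, mul_div_cancel₀ _ hpos.ne']
          · rw [smul_zero]; positivity
      _ = (1 / 3) * (1 - (1 / 4) ^ N) := by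
          rw [Finset.sum_congr rfl fun k _ => pow_succ (1 / 4 : ℝ) k, ← Finset.sum_mul,
            geom_sum_eq (by norm_num)]
          ring
      _ ≤ 1 / 3 := by
          have : (0 : ℝ) ≤ (1 / 4) ^ N := by positivity
          linarith
  linarith

/-- Reduction modulo `a`, for numbers below `2 * a`. -/
def Fin.fold {a b : ℕ} (h : b ≤ 2 * a) (i : Fin b) : Fin a :=
  if hi : (i : ℕ) < a then ⟨i, hi⟩ else ⟨i - a, by omega⟩

theorem Fin.card_fold_fiber_le {a b : ℕ} (h : b ≤ 2 * a) (x : Fin a) :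
    #{i : Fin b | Fin.fold h i = x} ≤ 2 := by
  rw [← Finset.card_map Fin.valEmbedding]
  refine (Finset.card_le_card (t := {(x : ℕ), (x : ℕ) + a}) ?_).trans Finset.card_le_two
  intro k hk
  simp only [Finset.mem_map, Finset.mem_filter, Finset.mem_univ, true_and,
    Fin.valEmbedding_apply] at hk
  obtain ⟨i, hi, rfl⟩ := hk
  unfold Fin.fold at hi
  split_ifs at hi with h1 <;> rw [Fin.ext_iff] at hi <;> simp at hi ⊢ <;> omega

theorem Fin.card_le_two_mul_card_image_fold {a b : ℕ} (h : b ≤ 2 * a) (A : Finset (Fin b)) :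
    #A ≤ 2 * #(A.image (Fin.fold h)) := by
  refine Finset.card_le_mul_card_image A 2 fun x _ => ?_
  exact (Finset.card_le_card (Finset.filter_subset_filter _ (Finset.subset_univ A))).trans
    (Fin.card_fold_fiber_le h x)

theorem Finset.card_filter_prod_fin_le {α : Type*} [Fintype α] {D c : ℕ}
    (P : α → Fin D → Prop) [∀ a j, Decidable (P a j)]
    (h : ∀ j, #{a | P a j} ≤ c) : #{q : α × Fin D | P q.1 q.2} ≤ D * c := by
  rw [Finset.card_filter, ← Finset.univ_product_univ, Finset.sum_product_right]
  calc _ ≤ ∑ _j : Fin D, c := Finset.sum_le_sum fun j _ => by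
        rw [← Finset.card_filter]; exact h j
    _ = D * c := by simp

/-- A bounded degree bipartite template which can be matched perfectly after removing any `s` of
the `m` flexible vertices. -/
theorem exists_template : ∃ Δ : ℕ, ∀ m s M : ℕ, s ≤ m → M + s = m + m →
    ∃ E : Finset (Fin M × (Fin m ⊕ Fin m)),
      (∀ w, #{e ∈ E | e.2 = w} ≤ Δ) ∧ (∀ x, #{e ∈ E | e.1 = x} ≤ Δ) ∧
      ∀ R : Finset (Fin m), #R = s → ∃ f : Fin M → Fin m ⊕ Fin m, Function.Injective f ∧
        ∀ x, (x, f x) ∈ E ∧ ∀ z ∈ R, f x ≠ Sum.inr z := by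
  obtain ⟨D, hD⟩ := exists_perm_expander
  refine ⟨3 * D, fun m s M hs hM => ?_⟩
  obtain ⟨σ, hσ⟩ := hD (m + m)
  have hMN : M ≤ m + m := by omega
  have hρ : m + m ≤ 2 * M := by omega
  have hy : m + m ≤ 2 * m := by omega
  set ρ := Fin.fold hρ with hρdef
  set y := Fin.fold hy with hydef
  set e : Fin (m + m) ≃ Fin m ⊕ Fin m := finSumFinEquiv.symm with he
  set ι : Fin M → Fin (m + m) := Fin.castLE hMN with hι
  have hιinj : Function.Injective ι := Fin.castLE_injective hMN
  have hρι : ∀ x, ρ (ι x) = x := by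
    intro x
    simp [hρdef, hι, Fin.fold]
  set α : Fin M × Fin D → Fin M × (Fin m ⊕ Fin m) :=
    fun q => (q.1, Sum.inl (y (σ q.2 (ι q.1)))) with hα
  set β : Fin (m + m) × Fin D → Fin M × (Fin m ⊕ Fin m) :=
    fun q => (ρ (σ q.2 q.1), e q.1) with hβ
  have hcard : ∀ (P : Fin M × (Fin m ⊕ Fin m) → Prop) [DecidablePred P] (a b : ℕ),
      #{q | P (α q)} ≤ a → #{q | P (β q)} ≤ b →
      #{q ∈ univ.image α ∪ univ.image β | P q} ≤ a + b := by
    intro P _ a b ha hb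
    rw [Finset.filter_union, Finset.filter_image, Finset.filter_image]
    exact (Finset.card_union_le _ _).trans
      (add_le_add (Finset.card_image_le.trans ha) (Finset.card_image_le.trans hb))
  have hone : ∀ {A B : Type} [Fintype A] [DecidableEq B] (g : A → B),
      Function.Injective g → ∀ b, #{a | g a = b} ≤ 1 := by
    intro A B _ _ g hg b
    rw [Finset.card_le_one]
    intro a ha a' ha'
    simp only [Finset.mem_filter, Finset.mem_univ, true_and] at ha ha'
    exact hg (ha.trans ha'.symm)
  refine ⟨univ.image α ∪ univ.image β, ?_, ?_, ?_⟩
  · intro w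
    refine (hcard (fun q => q.2 = w) (D * 2) (D * 1) ?_ ?_).trans (by omega)
    · refine Finset.card_filter_prod_fin_le (fun x j => Sum.inl (y (σ j (ι x))) = w) fun j => ?_
      obtain w | w := w
      · simp only [Sum.inl.injEq]
        rw [← Finset.card_image_of_injective _ ((σ j).injective.comp hιinj)]
        refine (Finset.card_le_card ?_).trans (Fin.card_fold_fiber_le hy w)
        intro i hi
        simp only [mem_image, mem_filter, mem_univ, true_and, Function.comp_apply] at hi ⊢
        obtain ⟨a, ha, rfl⟩ := hi
        exact ha
      · simp
    · exact Finset.card_filter_prod_fin_le (fun i _ => e i = w) fun j => hone e e.injective w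
  · intro x
    refine (hcard (fun q => q.1 = x) (D * 1) (D * 2) ?_ ?_).trans (by omega)
    · exact Finset.card_filter_prod_fin_le (fun i _ => i = x)
        fun j => hone id Function.injective_id x
    · refine Finset.card_filter_prod_fin_le (fun i j => ρ (σ j i) = x) fun j => ?_
      rw [← Finset.card_image_of_injective _ (σ j).injective]
      refine (Finset.card_le_card ?_).trans (Fin.card_fold_fiber_le hρ x)
      intro i hi
      simp only [mem_image, mem_filter, mem_univ, true_and] at hi ⊢
      obtain ⟨a, ha, rfl⟩ := hi
      exact ha
  · intro R hR
    set E := univ.image α ∪ univ.image β with hE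
    have hαE : ∀ x j, (x, Sum.inl (y (σ j (ι x)))) ∈ E := fun x j =>
      Finset.mem_union_left _ (Finset.mem_image_of_mem α (Finset.mem_univ (x, j)))
    have hβE : ∀ i j, (ρ (σ j i), e i) ∈ E := fun x j =>
      Finset.mem_union_right _ (Finset.mem_image_of_mem β (Finset.mem_univ (x, j)))
    set t : Fin M → Finset (Fin m ⊕ Fin m) :=
      fun x => {w | (x, w) ∈ E ∧ ∀ z ∈ R, w ≠ Sum.inr z} with ht
    have hmem : ∀ x w, w ∈ t x ↔ (x, w) ∈ E ∧ ∀ z ∈ R, w ≠ Sum.inr z := by simp [ht]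
    obtain ⟨f, hf, hft⟩ := (Finset.all_card_le_biUnion_card_iff_exists_injective t).mp (by
      intro S
      have hSι : #(S.image ι) = #S := Finset.card_image_of_injective _ hιinj
      by_cases hS : 16 * #S ≤ m + m
      · have h1 := (hσ (S.image ι)).1 (by rw [hSι]; exact hS)
        rw [hSι] at h1
        have h2 := Fin.card_le_two_mul_card_image_fold hy
          (univ.biUnion fun j => (S.image ι).image (σ j))
        have h3 : #S ≤ #(((univ.biUnion fun j => (S.image ι).image (σ j)).image y).image
            (Sum.inl : _ → Fin m ⊕ Fin m)) := by
          rw [Finset.card_image_of_injective _ Sum.inl_injective]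
          rw [← hydef] at h2; omega
        refine h3.trans (Finset.card_le_card ?_)
        intro w hw
        simp only [mem_image, mem_biUnion, mem_univ, true_and] at hw ⊢
        obtain ⟨_, ⟨_, ⟨j, _, ⟨x, hx, rfl⟩, rfl⟩, rfl⟩, rfl⟩ := hw
        exact ⟨x, hx, (hmem _ _).2 ⟨hαE x j, by simp⟩⟩
      · by_contra! hlt
        set A : Finset (Fin (m + m)) :=
          (univ \ (R.image Sum.inr ∪ S.biUnion t)).image e.symm with hA
        have hAcard : m + m ≤ #A + s + #(S.biUnion t) := by
          rw [hA, Finset.card_image_of_injective _ e.symm.injective, Finset.card_univ_sdiff]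
          have := Finset.card_union_le (R.image Sum.inr) (S.biUnion t)
          rw [Finset.card_image_of_injective _ Sum.inr_injective, hR] at this
          simp only [Fintype.card_sum, Fintype.card_fin]
          omega
        set T := univ.biUnion fun j => A.image (σ j) with hT
        have hTS : ∀ i ∈ T, ρ i ∉ S := by
          intro i hi hiS
          simp only [hT, hA, mem_biUnion, mem_image, mem_univ, true_and, mem_sdiff, mem_union,
            not_or] at hi
          obtain ⟨j, _, ⟨w, ⟨hw1, hw2⟩, rfl⟩, rfl⟩ := hi
          refine hw2 ⟨_, hiS, (hmem _ _).2 ⟨?_, fun z hz h => hw1 ⟨z, hz, h.symm⟩⟩⟩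
          simpa using hβE (e.symm w) j
        have hSM : #S ≤ M := by simpa using Finset.card_le_univ S
        by_cases hA16 : 16 * #A ≤ m + m
        · have h1 : 2 * #A ≤ #T := (hσ A).1 hA16
          have h2 : #T ≤ 2 * #(T.image ρ) := Fin.card_le_two_mul_card_image_fold hρ T
          have h3 : #(T.image ρ) + #S ≤ M := by
            rw [← Finset.card_union_of_disjoint]
            · simpa using Finset.card_le_univ (T.image ρ ∪ S)
            · rw [Finset.disjoint_left]
              intro x hx
              obtain ⟨i, hi, rfl⟩ := Finset.mem_image.mp hx
              exact hTS i hi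
          omega
        · have h1 : 15 * (m + m) < 16 * #T := (hσ A).2 (by omega)
          have h3 : #T + #(S.image ι) ≤ m + m := by
            rw [← Finset.card_union_of_disjoint]
            · simpa using Finset.card_le_univ (T ∪ S.image ι)
            · rw [Finset.disjoint_left]
              intro x hx hx'
              obtain ⟨i, hi, rfl⟩ := Finset.mem_image.mp hx'
              exact hTS _ hx (by rwa [hρι])
          omega)
    exact ⟨f, hf, fun x => (hmem _ _).1 (hft x)⟩

/-- Under a random colouring, the number of elements of `N` of a given colour is not much
smaller than expected, outside an exponentially small proportion of colourings. -/
theorem card_colorings_few_le {V : Type*} [Fintype V] [DecidableEq V] {k : ℕ} (hk : 0 < k)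
    (N : Finset V) {d : ℝ} (hd : d ≤ #N) (c : Fin k) :
    (#{f : V → Fin k | (#{u ∈ N | f u = c} : ℝ) < d / (4 * k)} : ℝ) ≤
      k ^ Fintype.card V * Real.exp (-(d / (4 * k))) := by
  have hk' : (0 : ℝ) < k := by exact_mod_cast hk
  have hk1 : (1 : ℝ) ≤ k := by exact_mod_cast hk
  set g : V → Fin k → ℝ := fun u c' => if u ∈ N ∧ c' = c then 1 / 2 else 1 with hg
  have hprod : ∀ f : V → Fin k, ∏ u, g u (f u) = (1 / 2 : ℝ) ^ #{u ∈ N | f u = c} := by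
    intro f
    rw [← Finset.prod_const, Finset.prod_filter, ← Finset.prod_filter_mul_prod_filter_not univ
      (· ∈ N)]
    rw [Finset.filter_mem_eq_inter, Finset.univ_inter]
    rw [Finset.prod_congr rfl (s₁ := univ.filter (· ∉ N)) (g := fun _ => (1 : ℝ))]
    · rw [Finset.prod_const_one, mul_one]
      refine Finset.prod_congr rfl fun u hu => ?_
      simp [hg, hu]
    · intro u hu
      have := (Finset.mem_filter.mp hu).2
      simp [hg, this]
  have hsum : ∑ f : V → Fin k, (1 / 2 : ℝ) ^ #{u ∈ N | f u = c} =
      k ^ Fintype.card V * (1 - 1 / (2 * k)) ^ #N := by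
    simp_rw [← hprod]
    rw [← Fintype.prod_sum]
    have h1 : ∀ u, ∑ c', g u c' = k * (if u ∈ N then 1 - 1 / (2 * (k : ℝ)) else 1) := by
      intro u
      by_cases hu : u ∈ N
      · have : ∀ c', g u c' = 1 - (if c' = c then 1 / 2 else 0) := by
          intro c'
          simp only [hg, hu, true_and]
          split_ifs <;> norm_num
        simp only [this, Finset.sum_sub_distrib, Finset.sum_ite_eq', mem_univ, if_true, hu]
        simp
        field_simp
      · simp [hg, hu]
    simp_rw [h1]
    rw [Finset.prod_mul_distrib, Finset.prod_const, Finset.card_univ, Finset.prod_ite_mem,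
      Finset.univ_inter, Finset.prod_const]
  have hmarkov : (#{f : V → Fin k | (#{u ∈ N | f u = c} : ℝ) < d / (4 * k)} : ℝ) *
      Real.exp (-(d / (4 * k))) ≤ ∑ f : V → Fin k, (1 / 2 : ℝ) ^ #{u ∈ N | f u = c} := by
    generalize hS : (univ.filter fun f : V → Fin k => (#{u ∈ N | f u = c} : ℝ) < d / (4 * k)) = S
    refine le_trans ?_ (Finset.sum_le_sum_of_subset_of_nonneg (Finset.subset_univ S)
      fun f _ _ => by positivity)
    rw [← nsmul_eq_mul]
    refine Finset.card_nsmul_le_sum _ _ _ fun f hf => ?_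
    rw [← hS] at hf
    have hf := (Finset.mem_filter.mp hf).2
    calc Real.exp (-(d / (4 * k))) ≤ Real.exp (-(#{u ∈ N | f u = c} : ℝ)) :=
          Real.exp_le_exp.mpr (by linarith)
      _ = Real.exp (-1) ^ #{u ∈ N | f u = c} := by rw [← Real.exp_nat_mul]; congr 1; ring
      _ ≤ (1 / 2) ^ #{u ∈ N | f u = c} := by
          refine pow_le_pow_left₀ (Real.exp_pos _).le ?_ _
          rw [Real.exp_neg, one_div]
          gcongr
          have := Real.add_one_le_exp (1 : ℝ)
          linarith
  have hpow : (1 - 1 / (2 * (k : ℝ))) ^ #N ≤ Real.exp (-(d / (2 * k))) := by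
    have h0 : 1 / (2 * (k : ℝ)) ≤ 1 := by
      rw [div_le_one (by positivity)]; linarith
    calc (1 - 1 / (2 * (k : ℝ))) ^ #N ≤ Real.exp (-(1 / (2 * k))) ^ #N := by
          refine pow_le_pow_left₀ (by linarith) ?_ _
          have := Real.add_one_le_exp (-(1 / (2 * (k : ℝ))))
          linarith
      _ = Real.exp (-(#N / (2 * k))) := by rw [← Real.exp_nat_mul]; congr 1; ring
      _ ≤ _ := by
          apply Real.exp_le_exp.mpr
          gcongr
  rw [hsum] at hmarkov
  have hexp : Real.exp (-(d / (2 * k))) = Real.exp (-(d / (4 * k))) * Real.exp (-(d / (4 * k))) := by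
    rw [← Real.exp_add]; congr 1; field_simp; ring
  have hpos := Real.exp_pos (-(d / (4 * k)))
  have h2 : (k : ℝ) ^ Fintype.card V * (1 - 1 / (2 * (k : ℝ))) ^ #N ≤
      k ^ Fintype.card V * (Real.exp (-(d / (4 * k))) * Real.exp (-(d / (4 * k)))) := by
    rw [← hexp]; gcongr
  refine le_of_mul_le_mul_right ?_ hpos
  linarith

/-- There is a colouring in which all the sets `N v` have many elements of every colour. -/
theorem exists_balanced_coloring {V : Type*} [Fintype V] [DecidableEq V] {k : ℕ} (hk : 0 < k)
    (N : V → Finset V) {d : ℝ} (hd : ∀ v, d ≤ #(N v))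
    (hlarge : Fintype.card V * k * Real.exp (-(d / (4 * k))) < 1) :
    ∃ f : V → Fin k, ∀ v c, d / (4 * k) ≤ (#{u ∈ N v | f u = c} : ℝ) := by
  by_contra! hcon
  have hk' : (0 : ℝ) < k := by exact_mod_cast hk
  have hcover : (univ : Finset (V → Fin k)) ⊆ (univ : Finset (V × Fin k)).biUnion fun q =>
      {f : V → Fin k | (#{u ∈ N q.1 | f u = q.2} : ℝ) < d / (4 * k)} := by
    intro f _
    obtain ⟨v, c, h⟩ := hcon f
    exact Finset.mem_biUnion.mpr ⟨(v, c), Finset.mem_univ _, by simpa using h⟩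
  have h1 : ((k : ℝ) ^ Fintype.card V) ≤
      Fintype.card V * k * (k ^ Fintype.card V * Real.exp (-(d / (4 * k)))) := by
    calc ((k : ℝ) ^ Fintype.card V) = (#(univ : Finset (V → Fin k)) : ℝ) := by simp
      _ ≤ ∑ q : V × Fin k,
            (#{f : V → Fin k | (#{u ∈ N q.1 | f u = q.2} : ℝ) < d / (4 * k)} : ℝ) := by
          rw [← Nat.cast_sum, Nat.cast_le]
          exact (Finset.card_le_card hcover).trans Finset.card_biUnion_le
      _ ≤ ∑ _q : V × Fin k, (k ^ Fintype.card V * Real.exp (-(d / (4 * k)))) :=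
          Finset.sum_le_sum fun q _ => card_colorings_few_le hk (N q.1) (hd q.1) q.2
      _ = _ := by simp
  have h2 : (0 : ℝ) < k ^ Fintype.card V := by positivity
  nlinarith

section Bijumbled

variable {V : Type} [DecidableEq V] {G : SimpleGraph V} [DecidableRel G.Adj]

theorem ePairs_eq_sum (A B : Finset V) : ePairs G A B = ∑ a ∈ A, #{b ∈ B | G.Adj a b} := by
  unfold ePairs
  rw [Finset.card_filter, Finset.sum_product]
  exact Finset.sum_congr rfl fun a _ => (Finset.card_filter _ _).symm

variable [Fintype V] {p κ : ℝ}

theorem Bijumbled.mono {lam lam' : ℝ} (h : Bijumbled G p lam) (hl : lam ≤ lam') :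
    Bijumbled G p lam' := fun A B hA hB =>
  (h A B hA hB).trans_le (mul_le_mul_of_nonneg_right hl (Real.sqrt_nonneg _))

theorem Bijumbled.exists_adj (h : Bijumbled G p (p * κ)) (hp : 0 < p) {A B : Finset V}
    (hA : A.Nonempty) (hB : B.Nonempty) (hAB : κ ^ 2 ≤ #A * #B) :
    ∃ a ∈ A, ∃ b ∈ B, G.Adj a b := by
  by_contra! hcon
  have h0 : ePairs G A B = 0 := by
    rw [ePairs_eq_sum]
    refine Finset.sum_eq_zero fun a ha => ?_
    rw [Finset.card_eq_zero, Finset.filter_eq_empty_iff]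
    exact fun b hb => hcon a ha b hb
  have h1 := h A B hA hB
  have hs : (0 : ℝ) ≤ #A * #B := by positivity
  have h2 : κ ≤ √((#A : ℝ) * #B) := Real.le_sqrt_of_sq_le hAB
  have h3 := Real.mul_self_sqrt hs
  have h4 : (0 : ℝ) ≤ √((#A : ℝ) * #B) := Real.sqrt_nonneg _
  rw [h0, Nat.cast_zero, zero_sub, abs_neg, mul_assoc, abs_of_nonneg (by positivity)] at h1
  have h5 : p * (√((#A : ℝ) * #B) * √((#A : ℝ) * #B)) < p * (κ * √((#A : ℝ) * #B)) := by
    rw [h3]; linarith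
  have h6 := lt_of_mul_lt_mul_left h5 hp.le
  nlinarith

/-- Few vertices have many neighbours in a small set. -/
theorem Bijumbled.card_many_neighbors_le (h : Bijumbled G p (p * κ)) {d : ℝ} (hd : 0 < d)
    {B Q : Finset V} (hQ : 2 * p * #Q ≤ d) (hBQ : ∀ v ∈ B, d ≤ #{u ∈ Q | G.Adj v u}) :
    d ^ 2 * #B ≤ 4 * (p * κ) ^ 2 * #Q := by
  rcases B.eq_empty_or_nonempty with rfl | hB
  · simp; positivity
  rcases Q.eq_empty_or_nonempty with rfl | hQ'
  · obtain ⟨v, hv⟩ := hB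
    have := hBQ v hv
    simp at this
    linarith
  have h1 := (abs_lt.mp (h B Q hB hQ')).2
  have h2 : d * #B ≤ ePairs G B Q := by
    rw [ePairs_eq_sum, mul_comm, ← nsmul_eq_mul]
    push_cast
    exact Finset.card_nsmul_le_sum _ _ _ hBQ
  have hBpos : (0 : ℝ) < #B := by exact_mod_cast hB.card_pos
  have hQpos : (0 : ℝ) < #Q := by exact_mod_cast hQ'.card_pos
  have h3 : p * #B * #Q ≤ d / 2 * #B := by nlinarith
  have h4 : d * #B ≤ 2 * ((p * κ) * √((#B : ℝ) * #Q)) := by linarith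
  have h5 : (d * #B) ^ 2 ≤ (2 * ((p * κ) * √((#B : ℝ) * #Q))) ^ 2 :=
    pow_le_pow_left₀ (by positivity) h4 2
  rw [mul_pow, mul_pow 2, mul_pow (p * κ), Real.sq_sqrt (by positivity)] at h5
  nlinarith

/-- Few vertices have few neighbours in a large set. -/
theorem Bijumbled.card_few_neighbors_mul_le (h : Bijumbled G p (p * κ)) (hp : 0 < p)
    {W N : Finset V} (hW : ∀ w ∈ W, (#{u ∈ N | G.Adj w u} : ℝ) ≤ p * #N / 2) :
    (#W * #N : ℝ) ≤ 4 * κ ^ 2 := by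
  rcases W.eq_empty_or_nonempty with rfl | hW'
  · simp; positivity
  rcases N.eq_empty_or_nonempty with rfl | hN
  · simp; positivity
  have h1 := (abs_lt.mp (h W N hW' hN)).1
  have h2 : (ePairs G W N : ℝ) ≤ #W * (p * #N / 2) := by
    rw [ePairs_eq_sum, ← nsmul_eq_mul]
    push_cast
    exact Finset.sum_le_card_nsmul _ _ _ hW
  have hs : (0 : ℝ) ≤ #W * #N := by positivity
  have hW0 : (0 : ℝ) < #W := by exact_mod_cast hW'.card_pos
  have hN0 : (0 : ℝ) < #N := by exact_mod_cast hN.card_pos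
  have h3 := Real.sq_sqrt hs
  have h4 : (0 : ℝ) < √((#W : ℝ) * #N) := Real.sqrt_pos.mpr (by positivity)
  set s := √((#W : ℝ) * #N)
  have h5 : p * s ^ 2 < p * (2 * κ * s) := by rw [h3]; linarith
  have h6 : s ^ 2 < 2 * κ * s := lt_of_mul_lt_mul_left h5 hp.le
  have h7 : s ≤ 2 * κ := by
    by_contra! hcon
    nlinarith
  rw [← h3]
  nlinarith

/-- A set into which all vertices have large degree is large. -/
theorem Bijumbled.le_card (h : Bijumbled G p (p * κ)) (hp : 0 < p) (hκ : 0 < κ) [Nonempty V]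
    {Ω : Finset V} {ω : ℝ} (hω : 0 < ω) (hΩ : ∀ v, p * ω ≤ #{u ∈ Ω | G.Adj v u}) :
    ω - κ ≤ #Ω := by
  have hne : Ω.Nonempty := by
    rw [Finset.nonempty_iff_ne_empty]
    rintro rfl
    have := hΩ (Classical.arbitrary V)
    simp at this
    nlinarith
  have h1 := (abs_lt.mp (h univ Ω univ_nonempty hne)).2
  have h2 : Fintype.card V * (p * ω) ≤ ePairs G univ Ω := by
    rw [ePairs_eq_sum, ← nsmul_eq_mul, ← Finset.card_univ]
    push_cast
    exact Finset.card_nsmul_le_sum _ _ _ fun v _ => hΩ v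
  have hn : (0 : ℝ) < Fintype.card V := by exact_mod_cast Fintype.card_pos
  rw [Finset.card_univ] at h1
  have h3 : √((Fintype.card V : ℝ) * #Ω) ≤ Fintype.card V := by
    apply Real.sqrt_le_iff.mpr ⟨hn.le, ?_⟩
    have : (#Ω : ℝ) ≤ Fintype.card V := by exact_mod_cast Finset.card_le_univ Ω
    nlinarith
  have h4 : p * κ * √((Fintype.card V : ℝ) * #Ω) ≤ p * κ * Fintype.card V := by gcongr
  have h5 : (p * Fintype.card V) * ω ≤ (p * Fintype.card V) * (#Ω + κ) := by linarith
  have := le_of_mul_le_mul_left h5 (by positivity)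
  linarith

/-- A vertex of not too large degree and its neighbourhood bound `p` from below. -/
theorem Bijumbled.degree_le {lam : ℝ} (h : Bijumbled G p lam) (hp2 : p ≤ 1 / 2) (hlam : 0 ≤ lam)
    (v : V) : (G.degree v : ℝ) ≤ 4 * lam ^ 2 := by
  set N := G.neighborFinset v with hN
  rcases N.eq_empty_or_nonempty with h0 | h0
  · rw [← SimpleGraph.card_neighborFinset_eq_degree, ← hN, h0]
    simp; positivity
  have h1 := (abs_lt.mp (h {v} N (by simp) h0)).2
  have h2 : ePairs G {v} N = #N := by
    rw [ePairs_eq_sum, Finset.sum_singleton, Finset.filter_true_of_mem]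
    intro b hb
    simpa [hN] using hb
  rw [h2, Finset.card_singleton, Nat.cast_one, mul_one, one_mul] at h1
  rw [← SimpleGraph.card_neighborFinset_eq_degree, ← hN]
  have h3 : (0 : ℝ) < #N := by exact_mod_cast h0.card_pos
  have h4 := Real.sq_sqrt h3.le
  have h5 : (0 : ℝ) < √(#N : ℝ) := Real.sqrt_pos.mpr h3
  set s := √(#N : ℝ)
  have h6 : s ^ 2 / 2 < lam * s := by rw [h4]; nlinarith
  rw [← h4]
  have h7 : s < 2 * lam := by
    by_contra! hcon
    nlinarith
  nlinarith

end Bijumbled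

/-- `F` is the vertex set of a cycle of `G`. -/
def IsCycleSet {V : Type} [DecidableEq V] (G : SimpleGraph V) (F : Finset V) : Prop :=
  ∃ (v : V) (c : G.Walk v v), c.IsCycle ∧ c.support.toFinset = F ∧ c.length = #F

theorem SimpleGraph.Walk.IsPath.card_toFinset_support {V : Type} [DecidableEq V]
    {G : SimpleGraph V} {x y : V} {q : G.Walk x y} (hq : q.IsPath) :
    #q.support.toFinset = q.length + 1 := by
  rw [List.toFinset_card_of_nodup hq.support_nodup, SimpleGraph.Walk.length_support]

/-- A path and a common neighbour of its ends form a cycle. -/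
theorem SimpleGraph.Walk.IsPath.isCycleSet_insert {V : Type} [DecidableEq V] {G : SimpleGraph V}
    {v x y : V} {q : G.Walk x y} (hq : q.IsPath) (hlen : 0 < q.length) (hv : v ∉ q.support)
    (hx : G.Adj v x) (hy : G.Adj v y) : IsCycleSet G (insert v q.support.toFinset) := by
  refine ⟨v, .cons hx (q.concat hy.symm), ?_, ?_, ?_⟩
  · rw [SimpleGraph.Walk.cons_isCycle_iff]
    refine ⟨hq.concat hv hy.symm, ?_⟩
    rw [SimpleGraph.Walk.edges_concat, List.concat_eq_append, List.mem_append]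
    rintro (h | h)
    · exact hv (SimpleGraph.Walk.fst_mem_support_of_mem_edges _ h)
    · rw [List.mem_singleton, Sym2.eq_iff] at h
      rcases h with ⟨rfl, -⟩ | ⟨-, rfl⟩
      · exact hv q.end_mem_support
      · rw [SimpleGraph.Walk.isPath_iff_nil, ← SimpleGraph.Walk.length_eq_zero_iff] at hq
        omega
  · ext z
    simp [SimpleGraph.Walk.support_concat]
  · rw [Finset.card_insert_of_notMem (by simpa using hv), hq.card_toFinset_support]
    simp

section Bijumbled

variable {V : Type} [Fintype V] [DecidableEq V] {G : SimpleGraph V} [DecidableRel G.Adj]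
  {p κ : ℝ}

/-- Two sets are joined by a path with `k` interior vertices in `Ω`. -/
theorem Bijumbled.exists_path_between (h : Bijumbled G p (p * κ)) (hp : 0 < p) {b : ℕ}
    (hκ : 0 < κ) (hb : 2 * κ ≤ b) (k : ℕ) : ∀ C₁ C₂ Ω : Finset V, Disjoint C₁ C₂ →
      Disjoint C₁ Ω → Disjoint C₂ Ω → k * b ≤ #Ω → 2 * κ ^ 2 ≤ #C₁ * b → 2 * κ ^ 2 ≤ #C₂ * b →
      (k = 0 → κ ^ 2 ≤ #C₁ * #C₂) →
      ∃ x ∈ C₁, ∃ y ∈ C₂, ∃ q : G.Walk x y, q.IsPath ∧ q.length = k + 1 ∧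
        ∀ z ∈ q.support, z = x ∨ z = y ∨ z ∈ Ω := by
  have hne : ∀ C : Finset V, 2 * κ ^ 2 ≤ #C * b → C.Nonempty := by
    intro C hC
    rw [Finset.nonempty_iff_ne_empty]
    rintro rfl
    simp at hC
    nlinarith
  induction k with
  | zero =>
    intro C₁ C₂ Ω h12 _ _ _ h1 h2 h3
    obtain ⟨x, hx, y, hy, hxy⟩ := h.exists_adj hp (hne _ h1) (hne _ h2) (h3 rfl)
    refine ⟨x, hx, y, hy, hxy.toWalk, ?_, by simp, ?_⟩
    · simpa using hxy.ne
    · intro z hz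
      simp at hz
      tauto
  | succ k ih =>
    intro C₁ C₂ Ω h12 h1Ω h2Ω hΩ h1 h2 _
    obtain ⟨B, hBΩ, hB⟩ := Finset.exists_subset_card_eq (s := Ω) (n := b) (by nlinarith)
    set R := B.filter fun r => ∃ x ∈ C₁, G.Adj x r with hR
    have hRB : R ⊆ B := Finset.filter_subset _ _
    have hcard : #R + #(B \ R) = b := by
      rw [Finset.card_sdiff_of_subset hRB, ← hB]
      have := Finset.card_le_card hRB
      omega
    have hcard' : (#R + #(B \ R) : ℝ) = b := by exact_mod_cast hcard
    have hRb : (b : ℝ) / 2 ≤ #R := by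
      by_contra! hcon
      have h5 : (b : ℝ) / 2 ≤ #(B \ R) := by linarith
      have hC1 : (0 : ℝ) ≤ #C₁ := by positivity
      obtain ⟨x, hx, r, hr, hxr⟩ := h.exists_adj hp (A := C₁) (B := B \ R) (hne _ h1) (by
        rw [← Finset.card_pos]
        have : (0 : ℝ) < #(B \ R) := by linarith
        exact_mod_cast this) (by nlinarith)
      rw [Finset.mem_sdiff] at hr
      exact hr.2 (Finset.mem_filter.mpr ⟨hr.1, x, hx, hxr⟩)
    have hRΩ : R ⊆ Ω := hRB.trans hBΩ
    have hC2 : (0 : ℝ) ≤ #C₂ := by positivity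
    obtain ⟨r, hr, y, hy, q, hq, hql, hqs⟩ := ih R C₂ (Ω \ B)
      (Finset.disjoint_of_subset_left hRΩ h2Ω.symm)
      (Finset.disjoint_of_subset_left hRB Finset.disjoint_sdiff)
      (Finset.disjoint_of_subset_right Finset.sdiff_subset h2Ω) (by
        rw [Finset.card_sdiff_of_subset hBΩ, hB]
        have : (k + 1) * b = k * b + b := by ring
        omega) (by nlinarith) h2 (fun _ => by nlinarith)
    obtain ⟨x, hx, hxr⟩ := (Finset.mem_filter.mp hr).2
    refine ⟨x, hx, y, hy, .cons hxr q, ?_, by simp [hql], ?_⟩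
    · rw [SimpleGraph.Walk.cons_isPath_iff]
      refine ⟨hq, fun hxq => ?_⟩
      rcases hqs x hxq with rfl | rfl | hx'
      · exact Finset.disjoint_left.mp h1Ω hx (hRΩ hr)
      · exact Finset.disjoint_left.mp h12 hx hy
      · exact Finset.disjoint_left.mp h1Ω hx (Finset.sdiff_subset hx')
    · intro z hz
      rw [SimpleGraph.Walk.support_cons, List.mem_cons] at hz
      rcases hz with rfl | hz
      · exact Or.inl rfl
      · rcases hqs z hz with rfl | rfl | hz'
        · exact Or.inr (Or.inr (hRΩ hr))
        · exact Or.inr (Or.inl rfl)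
        · exact Or.inr (Or.inr (Finset.sdiff_subset hz'))

/-- A path in `Ω` with both ends in `C`. -/
theorem Bijumbled.exists_path_within (h : Bijumbled G p (p * κ)) (hp : 0 < p) {b k : ℕ}
    (hκ : 0 < κ) (hb : 2 * κ ≤ b) {C Ω : Finset V} (hC : C ⊆ Ω) (h4 : 4 ≤ #C)
    (hCb : 16 * κ ^ 2 ≤ #C * b) (hΩ : 2 * ((k + 1) * b) ≤ #Ω) :
    ∃ x ∈ C, ∃ y ∈ C, ∃ q : G.Walk x y, q.IsPath ∧ q.length = k + 2 ∧
      q.support.toFinset ⊆ Ω := by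
  obtain ⟨C₁, hC₁, hC₁c⟩ := Finset.exists_subset_card_eq (s := C) (n := #C / 4) (by omega)
  obtain ⟨C₂, hC₂, hC₂c⟩ := Finset.exists_subset_card_eq (s := C \ C₁) (n := #C / 4) (by
    rw [Finset.card_sdiff_of_subset hC₁]; omega)
  have hC₂C : C₂ ⊆ C := hC₂.trans Finset.sdiff_subset
  have hdis : Disjoint C₁ C₂ := Finset.disjoint_of_subset_right hC₂ Finset.disjoint_sdiff
  have hq : (#C : ℝ) ≤ 8 * (#C / 4 : ℕ) := by
    have : #C ≤ 8 * (#C / 4) := by omega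
    exact_mod_cast this
  have hb0 : (0 : ℝ) ≤ b := by positivity
  obtain ⟨x, hx, y, hy, q, hq, hql, hqs⟩ := h.exists_path_between hp hκ hb (k + 1) C₁ C₂
    (Ω \ (C₁ ∪ C₂)) hdis (Finset.disjoint_of_subset_left subset_union_left Finset.disjoint_sdiff)
    (Finset.disjoint_of_subset_left subset_union_right Finset.disjoint_sdiff)
    (by
      have h1 := Finset.card_union_le C₁ C₂
      have h2 := Finset.card_le_card hC
      rw [Finset.card_sdiff_of_subset (Finset.union_subset (hC₁.trans hC) (hC₂C.trans hC))]
      omega)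
    (by rw [hC₁c]; nlinarith) (by rw [hC₂c]; nlinarith) (by omega)
  refine ⟨x, hC₁ hx, y, hC₂C hy, q, hq, hql, fun z hz => ?_⟩
  rcases hqs z (List.mem_toFinset.mp hz) with rfl | rfl | hz'
  · exact hC (hC₁ hx)
  · exact hC (hC₂C hy)
  · exact Finset.sdiff_subset hz'

/-- A vertex with many neighbours in `Ω` closes a cycle through `Ω`. -/
theorem Bijumbled.exists_cycle_through (h : Bijumbled G p (p * κ)) (hp : 0 < p) {b ℓ : ℕ}
    (hκ : 0 < κ) (hb : 2 * κ ≤ b) {C Ω : Finset V} (hC : C ⊆ Ω) (h4 : 4 ≤ #C)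
    (hCb : 16 * κ ^ 2 ≤ #C * b) (hℓ : 4 ≤ ℓ) (hΩ : 2 * (ℓ * b) ≤ #Ω) :
    ∃ P ⊆ Ω, #P + 1 = ℓ ∧ ∀ v ∉ Ω, (∀ u ∈ C, G.Adj v u) → IsCycleSet G (insert v P) := by
  obtain ⟨x, hx, y, hy, q, hq, hql, hqs⟩ := h.exists_path_within hp (k := ℓ - 4) hκ hb hC h4 hCb
    (le_trans (Nat.mul_le_mul_left 2 (Nat.mul_le_mul_right b (by omega))) hΩ)
  refine ⟨q.support.toFinset, hqs, ?_, fun v hv hvC => ?_⟩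
  · rw [hq.card_toFinset_support]; omega
  · exact hq.isCycleSet_insert (by omega) (fun hv' => hv (hqs (List.mem_toFinset.mpr hv')))
      (hvC x hx) (hvC y hy)

end Bijumbled

/-- Numerical conditions under which every vertex with `p * ω` neighbours in a set of size `ω`
closes cycles of length at most `L` through that set. -/
structure CycleScale {V : Type} [Fintype V] [DecidableEq V] (G : SimpleGraph V)
    [DecidableRel G.Adj] (p κ ω : ℝ) (b L : ℕ) : Prop where
  p_pos : 0 < p
  p_le : p ≤ 1 / 2
  κ_pos : 0 < κ
  bijumbled : Bijumbled G p (p * κ)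
  two_κ_le : 2 * κ ≤ b
  size : 2 * (L * b) + L + 1 ≤ ω
  path : 16 * κ ^ 2 ≤ (p * (p * ω) / 2 - L - 1) * b
  four : 4 ≤ p * (p * ω) / 2 - L - 1
  typical : 8 * κ ^ 2 < p * ω * ω

/-- `S` splits into two vertex sets of cycles of length `ℓ`. -/
def IsTwoCycleSet {V : Type} [DecidableEq V] (G : SimpleGraph V) (ℓ : ℕ) (S : Finset V) : Prop :=
  ∃ A B, Disjoint A B ∧ A ∪ B = S ∧ IsCycleSet G A ∧ #A = ℓ ∧ IsCycleSet G B ∧ #B = ℓ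

namespace CycleScale

variable {V : Type} [Fintype V] [DecidableEq V] {G : SimpleGraph V} [DecidableRel G.Adj]
  {p κ ω : ℝ} {b L : ℕ}

theorem ω_pos (h : CycleScale G p κ ω b L) : 0 < ω := by
  have := h.size
  have : (0 : ℝ) ≤ 2 * (L * b) + L := by positivity
  linarith [h.size]

/-- The basic cycle finding lemma, with all the ends of the path in the given set `C`. -/
theorem exists_cycle_of_subset (h : CycleScale G p κ ω b L) {ℓ : ℕ} (hℓ : 4 ≤ ℓ) (hL : ℓ ≤ L)
    {C Ω : Finset V} (hC : C ⊆ Ω) (hCc : p * (p * ω) / 2 - L - 1 ≤ #C)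
    (hΩ : ω - L - 1 ≤ #Ω) :
    ∃ P ⊆ Ω, #P + 1 = ℓ ∧ ∀ v ∉ Ω, (∀ u ∈ C, G.Adj v u) → IsCycleSet G (insert v P) := by
  have hb0 : (0 : ℝ) ≤ b := by positivity
  refine h.bijumbled.exists_cycle_through h.p_pos h.κ_pos h.two_κ_le hC ?_ ?_ hℓ ?_
  · have := h.four.trans hCc
    exact_mod_cast this
  · exact h.path.trans (mul_le_mul_of_nonneg_right hCc hb0)
  · have h1 := h.size
    have h2 : ((2 * (L * b) : ℕ) : ℝ) ≤ #Ω := by push_cast; linarith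
    have h3 : 2 * (L * b) ≤ #Ω := by exact_mod_cast h2
    exact (Nat.mul_le_mul_left 2 (Nat.mul_le_mul_right b hL)).trans h3

theorem exists_cycle (h : CycleScale G p κ ω b L) {ℓ : ℕ} (hℓ : 4 ≤ ℓ) (hL : ℓ ≤ L)
    {Ω : Finset V} (hΩ : ω ≤ #Ω) {v : V} (hv : v ∉ Ω) (hd : p * ω ≤ #{u ∈ Ω | G.Adj v u}) :
    ∃ P ⊆ Ω, #P + 1 = ℓ ∧ IsCycleSet G (insert v P) := by
  have h0 : (0 : ℝ) ≤ L := by positivity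
  have hpos := mul_pos h.p_pos h.ω_pos
  obtain ⟨P, hP, hPc, hPv⟩ := h.exists_cycle_of_subset hℓ hL (Finset.filter_subset (G.Adj v) Ω)
    (by nlinarith [h.p_le]) (by linarith)
  exact ⟨P, hP, hPc, hPv v hv fun u hu => (Finset.mem_filter.mp hu).2⟩

/-- Large sets contain cycles. -/
theorem exists_cycle_subset (h : CycleScale G p κ ω b L) {ℓ : ℕ} (hℓ : 4 ≤ ℓ) (hL : ℓ ≤ L)
    {U : Finset V} (hU : 2 * ω + 1 ≤ #U) : ∃ F ⊆ U, #F = ℓ ∧ IsCycleSet G F := by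
  have hω := h.ω_pos
  have hp := h.p_pos
  obtain ⟨v, hv, hvd⟩ : ∃ v ∈ U, p * #U / 2 < #{u ∈ U | G.Adj v u} := by
    by_contra! hcon
    have h1 := h.bijumbled.card_few_neighbors_mul_le hp hcon
    have h2 := h.typical
    have h3 : p * (ω * ω) ≤ 1 / 2 * (ω * ω) := by gcongr; exact h.p_le
    have h4 : ω * ω ≤ #U * #U := by nlinarith
    nlinarith
  have hfil : {u ∈ U | G.Adj v u} = {u ∈ U.erase v | G.Adj v u} := by
    ext u
    simp only [mem_filter, mem_erase]
    exact ⟨fun hu => ⟨⟨hu.2.ne', hu.1⟩, hu.2⟩, fun hu => ⟨hu.1.2, hu.2⟩⟩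
  have hcard : (#(U.erase v) : ℝ) + 1 = #U := by exact_mod_cast Finset.card_erase_add_one hv
  rw [hfil] at hvd
  obtain ⟨P, hP, hPc, hPv⟩ := h.exists_cycle hℓ hL (Ω := U.erase v) (v := v) (by linarith) (by simp)
    (by nlinarith)
  have hvP : v ∉ P := fun hvP => by simpa using hP hvP
  refine ⟨insert v P, ?_, by rw [Finset.card_insert_of_notMem hvP, hPc], hPv⟩
  exact Finset.insert_subset hv (hP.trans (Finset.erase_subset _ _))

/-- A set which forms two disjoint cycles with either of two given vertices. -/
theorem exists_switcher (h : CycleScale G p κ ω b L) {ℓ : ℕ} (hℓ : 4 ≤ ℓ) (hL : ℓ ≤ L)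
    {Ω : Finset V} (hΩ : ω ≤ #Ω) {u v : V} (hu : u ∉ Ω) (hv : v ∉ Ω)
    (hud : p * ω ≤ #{z ∈ Ω | G.Adj u z}) (hvd : p * ω ≤ #{z ∈ Ω | G.Adj v z}) :
    ∃ S ⊆ Ω, #S + 1 = 2 * ℓ ∧ IsTwoCycleSet G ℓ (insert u S) ∧ IsTwoCycleSet G ℓ (insert v S) := by
  have hω := h.ω_pos
  have hp := h.p_pos
  have hpω := mul_pos hp hω
  set Nu := {z ∈ Ω | G.Adj u z} with hNu
  set Nv := {z ∈ Ω | G.Adj v z} with hNv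
  obtain ⟨w, hw, hwu, hwv⟩ : ∃ w ∈ Ω, p * #Nu / 2 < #{z ∈ Nu | G.Adj w z} ∧
      p * #Nv / 2 < #{z ∈ Nv | G.Adj w z} := by
    by_contra! hcon
    set Wu := {w ∈ Ω | (#{z ∈ Nu | G.Adj w z} : ℝ) ≤ p * #Nu / 2} with hWu
    set Wv := {w ∈ Ω | (#{z ∈ Nv | G.Adj w z} : ℝ) ≤ p * #Nv / 2} with hWv
    have h1 : (#Wu * #Nu : ℝ) ≤ 4 * κ ^ 2 :=
      h.bijumbled.card_few_neighbors_mul_le hp fun w hw => (Finset.mem_filter.mp hw).2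
    have h2 : (#Wv * #Nv : ℝ) ≤ 4 * κ ^ 2 :=
      h.bijumbled.card_few_neighbors_mul_le hp fun w hw => (Finset.mem_filter.mp hw).2
    have h3 : Ω ⊆ Wu ∪ Wv := by
      intro w hw
      by_cases hwu : p * #Nu / 2 < #{z ∈ Nu | G.Adj w z}
      · exact Finset.mem_union_right _ (Finset.mem_filter.mpr ⟨hw, hcon w hw hwu⟩)
      · exact Finset.mem_union_left _ (Finset.mem_filter.mpr ⟨hw, not_lt.mp hwu⟩)
    have h4 : (#Ω : ℝ) ≤ #Wu + #Wv := by
      exact_mod_cast (Finset.card_le_card h3).trans (Finset.card_union_le _ _)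
    have h5 := h.typical
    have h6 : (0 : ℝ) ≤ #Wu := by positivity
    have h7 : (0 : ℝ) ≤ #Wv := by positivity
    have h8 : #Wu * (p * ω) ≤ 4 * κ ^ 2 := (mul_le_mul_of_nonneg_left hud h6).trans h1
    have h9 : #Wv * (p * ω) ≤ 4 * κ ^ 2 := (mul_le_mul_of_nonneg_left hvd h7).trans h2
    nlinarith
  have hℓL : (ℓ : ℝ) ≤ L := by exact_mod_cast hL
  have hsub : ∀ N ⊆ Ω, {z ∈ N | G.Adj w z} ⊆ Ω.erase w := by
    intro N hN z hz
    rw [Finset.mem_filter] at hz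
    exact Finset.mem_erase.mpr ⟨hz.2.ne', hN hz.1⟩
  have hmul : p * (p * ω) / 2 ≤ p * #Nu / 2 ∧ p * (p * ω) / 2 ≤ p * #Nv / 2 := by
    constructor <;> gcongr
  have hΩe : (#(Ω.erase w) : ℝ) + 1 = #Ω := by exact_mod_cast Finset.card_erase_add_one hw
  have hL0 : (0 : ℝ) ≤ L := by positivity
  obtain ⟨P, hP, hPc, hPcyc⟩ := h.exists_cycle_of_subset hℓ hL (hsub Nu (Finset.filter_subset _ _))
    (by linarith) (by linarith)
  have hP' : (#P : ℝ) + 1 = ℓ := by exact_mod_cast hPc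
  have hC : ({z ∈ Nv | G.Adj w z} \ P) ⊆ Ω.erase w \ P :=
    Finset.sdiff_subset_sdiff (hsub Nv (Finset.filter_subset _ _)) le_rfl
  have hCc : (#{z ∈ Nv | G.Adj w z} : ℝ) ≤ #({z ∈ Nv | G.Adj w z} \ P) + #P := by
    have := Finset.le_card_sdiff P {z ∈ Nv | G.Adj w z}
    exact_mod_cast (by omega : #{z ∈ Nv | G.Adj w z} ≤ #({z ∈ Nv | G.Adj w z} \ P) + #P)
  have hΩc : (#(Ω.erase w) : ℝ) ≤ #(Ω.erase w \ P) + #P := by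
    have := Finset.le_card_sdiff P (Ω.erase w)
    exact_mod_cast (by omega : #(Ω.erase w) ≤ #(Ω.erase w \ P) + #P)
  obtain ⟨P', hP', hPc', hPcyc'⟩ := h.exists_cycle_of_subset hℓ hL hC
    (by linarith) (by linarith)
  have hwP : w ∉ P := fun hw' => by simpa using hP hw'
  have hwP' : w ∉ P' := fun hw' => by simpa using hP' hw'
  have hPΩ : P ⊆ Ω := hP.trans (Finset.erase_subset _ _)
  have hPΩ' : P' ⊆ Ω := hP'.trans (Finset.sdiff_subset.trans (Finset.erase_subset _ _))
  have hPP' : Disjoint P P' := Finset.disjoint_of_subset_right hP' Finset.disjoint_sdiff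
  have hu1 : u ∉ P := fun hu' => hu (hPΩ hu')
  have hu2 : u ∉ P' := fun hu' => hu (hPΩ' hu')
  have hv1 : v ∉ P := fun hu' => hv (hPΩ hu')
  have hv2 : v ∉ P' := fun hu' => hv (hPΩ' hu')
  have huw : u ≠ w := fun huw => hu (huw ▸ hw)
  have hvw : v ≠ w := fun huw => hv (huw ▸ hw)
  have c1 : IsCycleSet G (insert u P) := hPcyc u (by simp [hu]) fun z hz =>
    (Finset.mem_filter.mp (Finset.mem_filter.mp hz).1).2
  have c2 : IsCycleSet G (insert w P) := hPcyc w (by simp) fun z hz =>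
    (Finset.mem_filter.mp hz).2
  have c3 : IsCycleSet G (insert w P') := hPcyc' w (by simp) fun z hz =>
    (Finset.mem_filter.mp (Finset.mem_sdiff.mp hz).1).2
  have c4 : IsCycleSet G (insert v P') := hPcyc' v (by simp [hv]) fun z hz =>
    (Finset.mem_filter.mp (Finset.mem_filter.mp (Finset.mem_sdiff.mp hz).1).1).2
  have hS : #(insert w (P ∪ P')) + 1 = 2 * ℓ := by
    rw [Finset.card_insert_of_notMem (by simp [hwP, hwP']), Finset.card_union_of_disjoint hPP']
    omega
  refine ⟨insert w (P ∪ P'), Finset.insert_subset hw (Finset.union_subset hPΩ hPΩ'), hS, ?_, ?_⟩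
  · refine ⟨insert u P, insert w P', ?_, ?_, c1, ?_, c3, ?_⟩
    · simp [Finset.disjoint_insert_left, Finset.disjoint_insert_right, *, Ne.symm huw]
    · ext z; simp; tauto
    · rw [Finset.card_insert_of_notMem hu1, hPc]
    · rw [Finset.card_insert_of_notMem hwP', hPc']
  · refine ⟨insert w P, insert v P', ?_, ?_, c2, ?_, c4, ?_⟩
    · simp [Finset.disjoint_insert_left, Finset.disjoint_insert_right, *]
    · ext z; simp
    · rw [Finset.card_insert_of_notMem hwP, hPc]
    · rw [Finset.card_insert_of_notMem hv2, hPc']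

/-- Pairwise disjoint structures in `Ω` attached to prescribed ports can be found by Haxell's
theorem, provided they exist robustly. -/
theorem exists_disjointChoice [Nonempty V] (h : CycleScale G p κ ω b L) {ι : Type} [Fintype ι] [DecidableEq ι]
    {r Δ : ℕ} (hI : 4 * (r * Fintype.card ι) ≤ ω) (hΔ : 8 * (Δ * r) * κ ^ 2 < ω ^ 2)
    {Ω : Finset V} (hΩ : ∀ v, p * (2 * ω) ≤ #{u ∈ Ω | G.Adj v u})
    (π : ι → Finset V) (hπ : ∀ v, #{i | v ∈ π i} ≤ Δ) (fam : ι → Finset V → Prop)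
    (hfam : ∀ i, ∀ Ω' ⊆ Ω, ω ≤ #Ω' → (∀ v ∈ π i, p * ω ≤ #{u ∈ Ω' | G.Adj v u}) →
      ∃ F ⊆ Ω', #F ≤ r ∧ fam i F) :
    ∃ φ : ι → Finset V, (∀ i, φ i ⊆ Ω ∧ fam i (φ i)) ∧ ∀ i j, i ≠ j → Disjoint (φ i) (φ j) := by
  have hω := h.ω_pos
  have hp := h.p_pos
  obtain ⟨φ, hφ, hdis⟩ := _root_.exists_disjointChoice (ι := ι) (r := r)
    (𝓕 := fun i F => F ⊆ Ω ∧ #F ≤ r ∧ fam i F) (fun i F hF => hF.2.1) (by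
    intro J hJ Q hQ
    have hJI : #J ≤ Fintype.card ι := Finset.card_le_univ J
    have hQ' : (#Q : ℝ) ≤ 2 * r * #J := by exact_mod_cast hQ
    have hQω : 2 * (#Q : ℝ) ≤ ω := by
      have : 2 * #Q ≤ 4 * (r * Fintype.card ι) := by nlinarith
      have : 2 * (#Q : ℝ) ≤ 4 * (r * Fintype.card ι) := by exact_mod_cast this
      linarith
    set B : Finset V := {v | p * ω ≤ #{u ∈ Q | G.Adj v u}} with hB
    have hBc := h.bijumbled.card_many_neighbors_le (mul_pos hp hω) (B := B) (Q := Q)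
      (by nlinarith) (fun v hv => (Finset.mem_filter.mp hv).2)
    have hlt : ∃ i ∈ J, Disjoint (π i) B := by
      by_contra! hcon
      have h1 : J ⊆ B.biUnion fun v => {i | v ∈ π i} := by
        intro i hi
        obtain ⟨v, hv1, hv2⟩ := Finset.not_disjoint_iff.mp (hcon i hi)
        exact Finset.mem_biUnion.mpr ⟨v, hv2, by simpa using hv1⟩
      have h2 : #J ≤ #B * Δ := (Finset.card_le_card h1).trans
        (Finset.card_biUnion_le_card_mul _ _ _ fun v _ => hπ v)
      have h2' : (#J : ℝ) ≤ #B * Δ := by exact_mod_cast h2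
      have hJ0 : (0 : ℝ) < #J := by exact_mod_cast hJ.card_pos
      have h3 : ω ^ 2 * #B ≤ 4 * κ ^ 2 * #Q := by
        have h4 : p ^ 2 * (ω ^ 2 * #B) ≤ p ^ 2 * (4 * κ ^ 2 * #Q) := by nlinarith
        exact le_of_mul_le_mul_left h4 (by positivity)
      have h5 : ω ^ 2 * #J ≤ (8 * (Δ * r) * κ ^ 2) * #J := by
        calc ω ^ 2 * #J ≤ ω ^ 2 * (#B * Δ) := by gcongr
          _ = (ω ^ 2 * #B) * Δ := by ring
          _ ≤ (4 * κ ^ 2 * (2 * r * #J)) * Δ := by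
              refine mul_le_mul_of_nonneg_right (h3.trans ?_) (by positivity)
              gcongr
          _ = _ := by ring
      nlinarith
    obtain ⟨i, hi, hiB⟩ := hlt
    have hΩc := h.bijumbled.le_card hp h.κ_pos (by linarith : 0 < 2 * ω) hΩ
    have hκω : 2 * κ ≤ ω := by
      nlinarith [h.typical, h.p_le, h.κ_pos, mul_pos hω hω]
    obtain ⟨F, hF, hFr, hFf⟩ := hfam i (Ω \ Q) Finset.sdiff_subset (by
      have := Finset.le_card_sdiff Q Ω
      have : (#Ω : ℝ) ≤ #(Ω \ Q) + #Q := by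
        exact_mod_cast (by omega : #Ω ≤ #(Ω \ Q) + #Q)
      linarith) (by
      intro v hv
      have hvB : v ∉ B := Finset.disjoint_left.mp hiB hv
      have h1 : (#{u ∈ Q | G.Adj v u} : ℝ) < p * ω := by simpa [hB] using hvB
      have h2 : #{u ∈ Ω | G.Adj v u} ≤ #{u ∈ Ω \ Q | G.Adj v u} + #{u ∈ Q | G.Adj v u} := by
        refine (Finset.card_le_card ?_).trans (Finset.card_union_le _ _)
        intro u hu
        simp only [mem_filter, mem_union, mem_sdiff] at hu ⊢
        tauto
      have h2' : (#{u ∈ Ω | G.Adj v u} : ℝ) ≤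
        #{u ∈ Ω \ Q | G.Adj v u} + #{u ∈ Q | G.Adj v u} := by exact_mod_cast h2
      linarith [hΩ v])
    exact ⟨i, hi, F, ⟨hF.trans Finset.sdiff_subset, hFr, hFf⟩,
      Finset.disjoint_of_subset_left hF Finset.sdiff_disjoint⟩)
  exact ⟨φ, fun i => ⟨(hφ i).1, (hφ i).2.2⟩, hdis⟩

end CycleScale

/-- `S` contains pairwise disjoint vertex sets of cycles whose lengths form the multiset `M`. -/
def HasCycles {V : Type} [DecidableEq V] (G : SimpleGraph V) (M : Multiset ℕ) (S : Finset V) :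
    Prop :=
  ∃ Fs : List (Finset V), Fs.Pairwise Disjoint ∧ (∀ F ∈ Fs, IsCycleSet G F ∧ F ⊆ S) ∧
    ((Fs.map card : List ℕ) : Multiset ℕ) = M

namespace HasCycles

variable {V : Type} [DecidableEq V] {G : SimpleGraph V} {M M₁ M₂ : Multiset ℕ}
  {S S₁ S₂ T : Finset V}

theorem zero (S : Finset V) : HasCycles G 0 S := ⟨[], by simp⟩

theorem mono (h : HasCycles G M S) (hST : S ⊆ T) : HasCycles G M T := by
  obtain ⟨Fs, h1, h2, h3⟩ := h
  exact ⟨Fs, h1, fun F hF => ⟨(h2 F hF).1, (h2 F hF).2.trans hST⟩, h3⟩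

theorem singleton {ℓ : ℕ} (hS : IsCycleSet G S) (hc : #S = ℓ) :
    HasCycles G {ℓ} S := ⟨[S], by simp [hS, hc]⟩

theorem add (h₁ : HasCycles G M₁ S₁) (h₂ : HasCycles G M₂ S₂) (hd : Disjoint S₁ S₂) :
    HasCycles G (M₁ + M₂) (S₁ ∪ S₂) := by
  obtain ⟨Fs, h1, h2, rfl⟩ := h₁
  obtain ⟨Fs', h1', h2', rfl⟩ := h₂
  refine ⟨Fs ++ Fs', ?_, ?_, by simp⟩
  · rw [List.pairwise_append]
    exact ⟨h1, h1', fun F hF F' hF' => hd.mono (h2 F hF).2 (h2' F' hF').2⟩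
  · intro F hF
    rcases List.mem_append.mp hF with hF | hF
    · exact ⟨(h2 F hF).1, (h2 F hF).2.trans subset_union_left⟩
    · exact ⟨(h2' F hF).1, (h2' F hF).2.trans subset_union_right⟩

theorem of_isTwoCycleSet {ℓ : ℕ} (hS : IsTwoCycleSet G ℓ S) :
    HasCycles G (Multiset.replicate 2 ℓ) S := by
  obtain ⟨A, B, hAB, rfl, hA, hAc, hB, hBc⟩ := hS
  exact (singleton hA hAc).add (singleton hB hBc) hAB

theorem biUnion {ι : Type} [DecidableEq ι] (I : Finset ι) {M : Multiset ℕ} {S : ι → Finset V}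
    (h : ∀ i ∈ I, HasCycles G M (S i)) (hd : ∀ i ∈ I, ∀ j ∈ I, i ≠ j → Disjoint (S i) (S j)) :
    HasCycles G (#I • M) (I.biUnion S) := by
  induction I using Finset.induction_on with
  | empty => simpa using zero _
  | insert i I hi ih =>
    rw [Finset.card_insert_of_notMem hi, Finset.biUnion_insert, add_comm, add_nsmul, one_nsmul]
    refine (h i (by simp)).add (ih (fun j hj => h j (by simp [hj]))
      fun j hj k hk => hd j (by simp [hj]) k (by simp [hk])) ?_
    rw [Finset.disjoint_biUnion_right]
    exact fun j hj => hd i (by simp) j (by simp [hj]) fun hij => hi (hij ▸ hj)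

/-- Indexing the cycles. -/
theorem exists_indexed {ι : Type} [DecidableEq ι] (I : Finset ι) (ℓ : ι → ℕ) :
    ∀ {S : Finset V}, HasCycles G (I.val.map ℓ) S →
    ∃ F : ι → Finset V, (∀ i ∈ I, IsCycleSet G (F i) ∧ #(F i) = ℓ i ∧ F i ⊆ S) ∧
      ∀ i ∈ I, ∀ j ∈ I, i ≠ j → Disjoint (F i) (F j) := by
  induction I using Finset.induction_on with
  | empty => intro S _; exact ⟨fun _ => ∅, by simp⟩
  | insert i I hi ih =>
    rintro S ⟨Fs, h1, h2, h3⟩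
    rw [Finset.insert_val_of_notMem hi, Multiset.map_cons] at h3
    have hmem : ℓ i ∈ ((Fs.map card : List ℕ) : Multiset ℕ) := by rw [h3]; simp
    rw [Multiset.mem_coe, List.mem_map] at hmem
    obtain ⟨F₀, hF₀, hF₀c⟩ := hmem
    have hperm := List.perm_cons_erase hF₀
    have hpw := (hperm.pairwise_iff fun {x y} h => Disjoint.symm h).mp h1
    rw [List.pairwise_cons] at hpw
    have hsub : ∀ F ∈ Fs.erase F₀, F ∈ Fs := fun F hF => List.mem_of_mem_erase hF
    obtain ⟨F, hF, hFd⟩ := ih (S := S \ F₀) ⟨Fs.erase F₀, hpw.2, fun F hF =>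
      ⟨(h2 F (hsub F hF)).1, Finset.subset_sdiff.mpr ⟨(h2 F (hsub F hF)).2, (hpw.1 F hF).symm⟩⟩, by
      have := Multiset.coe_eq_coe.mpr (hperm.map card)
      rw [h3, List.map_cons, ← Multiset.cons_coe, hF₀c] at this
      exact ((Multiset.cons_inj_right _).mp this).symm⟩
    have hne : ∀ j ∈ I, j ≠ i := fun j hj hji => hi (hji ▸ hj)
    refine ⟨Function.update F i F₀, ?_, ?_⟩
    · intro j hj
      rcases Finset.mem_insert.mp hj with rfl | hj
      · simpa using ⟨(h2 F₀ hF₀).1, hF₀c, (h2 F₀ hF₀).2⟩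
      · rw [Function.update_of_ne (hne j hj)]
        exact ⟨(hF j hj).1, (hF j hj).2.1, (hF j hj).2.2.trans Finset.sdiff_subset⟩
    · intro j hj k hk hjk
      rcases Finset.mem_insert.mp hj with rfl | hj' <;>
        rcases Finset.mem_insert.mp hk with rfl | hk'
      · exact absurd rfl hjk
      · rw [Function.update_self, Function.update_of_ne (hne k hk')]
        exact Finset.disjoint_of_subset_right (hF k hk').2.2 Finset.disjoint_sdiff
      · rw [Function.update_self, Function.update_of_ne (hne j hj')]
        exact Finset.disjoint_of_subset_left (hF j hj').2.2 Finset.sdiff_disjoint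
      · rw [Function.update_of_ne (hne j hj'), Function.update_of_ne (hne k hk')]
        exact hFd j hj' k hk' hjk

/-- Greedy packing. -/
theorem exists_greedy {K L : ℕ}
    (hK : ∀ ℓ, 4 ≤ ℓ → ℓ ≤ L → ∀ U : Finset V, K ≤ #U → ∃ F ⊆ U, #F = ℓ ∧ IsCycleSet G F)
    (S : Finset V) (M : Multiset ℕ) (hM : ∀ ℓ ∈ M, 4 ≤ ℓ ∧ ℓ ≤ L) (hS : M.sum + K ≤ #S) :
    ∃ T ⊆ S, #T = M.sum ∧ HasCycles G M T := by
  induction M using Multiset.induction_on with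
  | empty => exact ⟨∅, by simp, by simp, zero _⟩
  | cons ℓ M ih =>
    rw [Multiset.sum_cons] at hS
    obtain ⟨T, hT, hTc, hTM⟩ := ih (fun ℓ' hℓ' => hM ℓ' (by simp [hℓ'])) (by omega)
    have hℓ := hM ℓ (by simp)
    obtain ⟨F, hF, hFc, hFG⟩ := hK ℓ hℓ.1 hℓ.2 (S \ T) (by
      rw [Finset.card_sdiff_of_subset hT]; omega)
    have hd : Disjoint F T := Finset.disjoint_of_subset_left hF Finset.sdiff_disjoint
    refine ⟨F ∪ T, Finset.union_subset (hF.trans Finset.sdiff_subset) hT, ?_, ?_⟩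
    · rw [Finset.card_union_of_disjoint hd, hFc, hTc, Multiset.sum_cons]
    · rw [← Multiset.singleton_add]
      exact (singleton hFG hFc).add hTM hd

end HasCycles

/-- The absorbing structure decomposes into cycles for every matching of the template. -/
theorem HasCycles.absorber {V : Type} [DecidableEq V] {G : SimpleGraph V} {a m M : ℕ}
    {E : Finset (Fin M × (Fin m ⊕ Fin m))} {port : Fin m ⊕ Fin m → V} {g : Fin M × Fin a → V}
    {C : E → Finset V} {c : E → Fin a → V} {S : E × Fin a → Finset V} (ρ : V → ℕ)
    (hport : Function.Injective port) (hg : Function.Injective g)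
    (hc : ∀ e, Function.Injective (c e)) (hcC : ∀ e i, c e i ∈ C e)
    (hCd : ∀ e e', e ≠ e' → Disjoint (C e) (C e')) (hSd : ∀ q q', q ≠ q' → Disjoint (S q) (S q'))
    (hC : ∀ e, #(C e) = a ∧ IsCycleSet G (insert (port e.1.2) (C e)))
    (hS : ∀ q, IsTwoCycleSet G (a + 1) (insert (c q.1 q.2) (S q)) ∧
      IsTwoCycleSet G (a + 1) (insert (g (q.1.1.1, q.2)) (S q)))
    (hρp : ∀ w, ρ (port w) = 0) (hρg : ∀ q, ρ (g q) = 1) (hρC : ∀ e, ∀ v ∈ C e, ρ v = 2)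
    (hρS : ∀ q, ∀ v ∈ S q, ρ v = 3) {f : Fin M → Fin m ⊕ Fin m} (hf : Function.Injective f)
    (hfE : ∀ x, (x, f x) ∈ E) :
    HasCycles G (Multiset.replicate (M + 2 * (#E * a)) (a + 1))
      (univ.image (fun x => port (f x)) ∪ (univ.image g ∪ univ.biUnion C ∪ univ.biUnion S)) := by
  set B₁ : Fin M → Finset V := fun x => insert (port (f x)) (C ⟨_, hfE x⟩) with hB₁
  set ex : E × Fin a → V := fun q => if f q.1.1.1 = q.1.1.2 then g (q.1.1.1, q.2) else c q.1 q.2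
    with hex
  set B₂ : E × Fin a → Finset V := fun q => insert (ex q) (S q) with hB₂
  have hCeq : ∀ e e' v, v ∈ C e → v ∈ C e' → e = e' := fun e e' v h h' => by
    by_contra hne
    exact Finset.disjoint_left.mp (hCd e e' hne) h h'
  have hSeq : ∀ e e' v, v ∈ S e → v ∈ S e' → e = e' := fun e e' v h h' => by
    by_contra hne
    exact Finset.disjoint_left.mp (hSd e e' hne) h h'
  have hex3 : ∀ q, ρ (ex q) = 1 ∨ ρ (ex q) = 2 := by
    intro q
    simp only [hex]
    split_ifs
    · exact Or.inl (hρg _)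
    · exact Or.inr (hρC _ _ (hcC _ _))
  have hexinj : Function.Injective ex := by
    rintro ⟨⟨⟨x, w⟩, he⟩, i⟩ ⟨⟨⟨x', w'⟩, he'⟩, i'⟩ h
    simp only [hex] at h
    split_ifs at h with h1 h2 h2
    · have := hg h
      rw [Prod.mk.injEq] at this
      obtain ⟨rfl, rfl⟩ := this
      obtain rfl : w = w' := h1.symm.trans h2
      rfl
    · have := congrArg ρ h
      rw [hρg, hρC _ _ (hcC _ _)] at this
      omega
    · have := congrArg ρ h
      rw [hρg, hρC _ _ (hcC _ _)] at this
      omega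
    · have h3 := hCeq _ _ _ (hcC ⟨(x, w), he⟩ i) (by rw [h]; exact hcC ⟨(x', w'), he'⟩ i')
      rw [Subtype.mk.injEq, Prod.mk.injEq] at h3
      obtain ⟨rfl, rfl⟩ := h3
      rw [hc _ h]
  have h₁ : HasCycles G (#(univ : Finset (Fin M)) • {a + 1}) (univ.biUnion B₁) := by
    refine HasCycles.biUnion _ (fun x _ => HasCycles.singleton (hC ⟨_, hfE x⟩).2 ?_) ?_
    · rw [Finset.card_insert_of_notMem, (hC _).1]
      intro h
      have := hρC _ _ h
      rw [hρp] at this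
      omega
    · intro x _ y _ hxy
      rw [Finset.disjoint_left]
      intro v hv hv'
      simp only [hB₁, Finset.mem_insert] at hv hv'
      rcases hv with rfl | hv <;> rcases hv' with hv' | hv'
      · exact hxy (hf (hport hv'))
      · have := hρC _ _ hv'; rw [hρp] at this; omega
      · have := hρC _ _ hv; rw [hv', hρp] at this; omega
      · have := hCeq _ _ _ hv hv'
        rw [Subtype.mk.injEq, Prod.mk.injEq] at this
        exact hxy this.1
  have h₂ : HasCycles G (#(univ : Finset (E × Fin a)) • Multiset.replicate 2 (a + 1))
      (univ.biUnion B₂) := by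
    refine HasCycles.biUnion _ (fun q _ => HasCycles.of_isTwoCycleSet ?_) ?_
    · simp only [hB₂, hex]
      split_ifs
      · exact (hS q).2
      · exact (hS q).1
    · intro x _ y _ hxy
      rw [Finset.disjoint_left]
      intro v hv hv'
      simp only [hB₂, Finset.mem_insert] at hv hv'
      rcases hv with rfl | hv <;> rcases hv' with hv' | hv'
      · exact hxy (hexinj hv')
      · have := hρS _ _ hv'; have := hex3 x; omega
      · have := hρS _ _ hv; have := hex3 y; rw [← hv'] at this; omega
      · exact hxy (hSeq _ _ _ hv hv')
  have h := h₁.add h₂ (by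
    simp only [Finset.disjoint_biUnion_left, Finset.disjoint_biUnion_right]
    intro q _ x _
    rw [Finset.disjoint_left]
    intro v hv hv'
    simp only [hB₂, hB₁, Finset.mem_insert] at hv hv'
    rcases hv' with rfl | hv'
    · have h3 := hex3 q
      rcases hv with hv | hv
      · rw [hv, hρp] at h3; omega
      · simp only [hex] at hv h3
        split_ifs at hv h3 with h4
        · rw [hρC _ _ hv] at h3
          have := hρC _ _ hv
          rw [hρg] at this
          omega
        · have := hCeq _ _ _ hv (hcC q.1 q.2)
          apply h4
          rw [← this]
    · have := hρS _ _ hv'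
      rcases hv with rfl | hv
      · rw [hρp] at this; omega
      · have := hρC _ _ hv; omega)
  have hM : #(univ : Finset (Fin M)) • {a + 1} + #(univ : Finset (E × Fin a)) •
      Multiset.replicate 2 (a + 1) = Multiset.replicate (M + 2 * (#E * a)) (a + 1) := by
    rw [Multiset.nsmul_singleton, Multiset.nsmul_replicate, ← Multiset.replicate_add]
    simp [mul_comm]
  rw [hM] at h
  refine h.mono ?_
  intro v hv
  simp only [mem_union, mem_biUnion, mem_univ, true_and, mem_image, hB₁, hB₂, mem_insert] at hv ⊢
  rcases hv with ⟨x, rfl | hv⟩ | ⟨q, rfl | hv⟩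
  · exact Or.inl ⟨x, rfl⟩
  · exact Or.inr (Or.inl (Or.inr ⟨_, hv⟩))
  · simp only [hex]
    split_ifs
    · exact Or.inr (Or.inl (Or.inl ⟨_, rfl⟩))
    · exact Or.inr (Or.inl (Or.inr ⟨_, hcC _ _⟩))
  · exact Or.inr (Or.inr ⟨q, hv⟩)

theorem Finset.exists_enumeration {ι V : Type} [Fintype ι] [DecidableEq V] {S : Finset V}
    (h : #S = Fintype.card ι) : ∃ f : ι → V, Function.Injective f ∧ univ.image f = S := by
  obtain ⟨e⟩ : Nonempty (ι ≃ S) := by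
    rw [← Fintype.card_eq, Fintype.card_coe, h]
  refine ⟨fun i => e i, Subtype.val_injective.comp e.injective, ?_⟩
  ext v
  simp only [mem_image, mem_univ, true_and]
  exact ⟨fun ⟨i, hi⟩ => hi ▸ (e i).2, fun hv => ⟨e.symm ⟨v, hv⟩, by simp⟩⟩

theorem Finset.card_filter_eq_le_one {ι V : Type} [Fintype ι] [DecidableEq V] {f : ι → V}
    (hf : Function.Injective f) (v : V) : #{i | v = f i} ≤ 1 := by
  rw [Finset.card_le_one]
  intro i hi j hj
  simp only [mem_filter, mem_univ, true_and] at hi hj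
  exact hf (hi.symm.trans hj)

theorem Finset.card_filter_comp_le {ι V κ : Type} [Fintype ι] [DecidableEq V] [DecidableEq κ]
    {f : κ → V} (hf : Function.Injective f) {g : ι → κ} {Δ : ℕ} (hg : ∀ k, #{i | g i = k} ≤ Δ)
    (v : V) : #{i | v = f (g i)} ≤ Δ := by
  by_cases h : ∃ k, v = f k
  · obtain ⟨k, rfl⟩ := h
    refine (Finset.card_le_card ?_).trans (hg k)
    intro i hi
    simp only [mem_filter, mem_univ, true_and] at hi ⊢
    exact (hf hi).symm
  · rw [Finset.filter_false_of_mem]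
    · simp
    · intro i _ hi
      exact h ⟨_, hi⟩

theorem Finset.card_filter_coe_le {α : Type} {E : Finset α} (P : α → Prop)
    [DecidablePred P] : #{e : E | P e} ≤ #{e ∈ E | P e} := by
  rw [← Finset.card_map (Function.Embedding.subtype (· ∈ E))]
  refine Finset.card_le_card fun e he => ?_
  simp only [Finset.mem_map, mem_filter, mem_univ, true_and] at he ⊢
  obtain ⟨e, he, rfl⟩ := he
  exact ⟨e.2, he⟩

/-- Absorption: given the template, the reservoirs `Ω₁`, `Ω₂`, the flexible set `Z` and a pool of
further vertices, cycles with lengths `M'` extend to a packing together with many cycles of length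
`a + 1`. -/
theorem CycleScale.hasCycles_add_replicate {V : Type} [Fintype V] [DecidableEq V] [Nonempty V]
    {G : SimpleGraph V} [DecidableRel G.Adj] {p κ ω ωZ ωU : ℝ} {b bZ bU a L Δ m u M : ℕ}
    (h : CycleScale G p κ ω b L) (hZ : CycleScale G p κ ωZ bZ L) (hU : CycleScale G p κ ωU bU L)
    (ha : 4 ≤ a + 1) (haL : a + 1 ≤ L)
    (hM : M + a * u = m + m) {E : Finset (Fin M × (Fin m ⊕ Fin m))}
    (hE₂ : ∀ w, #{e ∈ E | e.2 = w} ≤ Δ) (hE₁ : ∀ x, #{e ∈ E | e.1 = x} ≤ Δ)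
    (hE : ∀ R : Finset (Fin m), #R = a * u → ∃ f : Fin M → Fin m ⊕ Fin m,
      Function.Injective f ∧ ∀ x, (x, f x) ∈ E ∧ ∀ z ∈ R, f x ≠ Sum.inr z)
    {Ω₁ Ω₂ Z Pool : Finset V} (h12 : Disjoint Ω₁ Ω₂) (h1Z : Disjoint Ω₁ Z) (h2Z : Disjoint Ω₂ Z)
    (h1P : Disjoint Ω₁ Pool) (h2P : Disjoint Ω₂ Pool) (hZP : Disjoint Z Pool)
    (hZm : #Z = m) (hPool : m + M * a ≤ #Pool)
    (hd₁ : ∀ v, p * (2 * ω) ≤ #{u ∈ Ω₁ | G.Adj v u})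
    (hd₂ : ∀ v, p * (2 * ω) ≤ #{u ∈ Ω₂ | G.Adj v u})
    (hdZ : ∀ v, p * (2 * ωZ) ≤ #{u ∈ Z | G.Adj v u})
    (hω : 4 * ((2 * a + 1) * (#E * a)) ≤ ω) (hωZ : 4 * ((2 * a + 1) * u) ≤ ωZ)
    (hωκ : 8 * ((Δ + 1) * (2 * a + 1)) * κ ^ 2 < ω ^ 2)
    (hωZκ : 8 * ((Δ + 1) * (2 * a + 1)) * κ ^ 2 < ωZ ^ 2)
    (hu : 2 * ωU + 1 ≤ u) (M' : Multiset ℕ) (hM' : ∀ ℓ ∈ M', 4 ≤ ℓ ∧ ℓ ≤ L)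
    (hsum : M'.sum + (M + 2 * (#E * a) + u) * (a + 1) ≤ Fintype.card V) :
    HasCycles G (M' + Multiset.replicate (M + 2 * (#E * a) + u) (a + 1)) univ := by
  obtain ⟨Y, hYP, hYm⟩ := Finset.exists_subset_card_eq (s := Pool) (n := m) (by omega)
  obtain ⟨Gr, hGrP, hGrm⟩ := Finset.exists_subset_card_eq (s := Pool \ Y) (n := M * a) (by
    rw [Finset.card_sdiff_of_subset hYP]; omega)
  have hGrP' : Gr ⊆ Pool := hGrP.trans Finset.sdiff_subset
  have hGrY : Disjoint Gr Y := Finset.disjoint_of_subset_left hGrP Finset.sdiff_disjoint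
  obtain ⟨y, hy, hyY⟩ := Finset.exists_enumeration (ι := Fin m) (S := Y) (by simpa using hYm)
  obtain ⟨z, hz, hzZ⟩ := Finset.exists_enumeration (ι := Fin m) (S := Z) (by simpa using hZm)
  obtain ⟨g, hg, hgG⟩ := Finset.exists_enumeration (ι := Fin M × Fin a) (S := Gr)
    (by simpa using hGrm)
  have hyY' : ∀ i, y i ∈ Y := fun i => by rw [← hyY]; simp
  have hzZ' : ∀ i, z i ∈ Z := fun i => by rw [← hzZ]; simp
  have hgG' : ∀ q, g q ∈ Gr := fun q => by rw [← hgG]; simp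
  have hZY : Disjoint Z Y := Finset.disjoint_of_subset_right hYP hZP
  set port : Fin m ⊕ Fin m → V := Sum.elim y z with hport
  have hportmem : ∀ w, port w ∈ Y ∪ Z := by
    rintro (i | i)
    · exact Finset.mem_union_left _ (hyY' i)
    · exact Finset.mem_union_right _ (hzZ' i)
  have hportinj : Function.Injective port := by
    refine hy.sumElim hz fun i j hij => ?_
    exact Finset.disjoint_left.mp hZY (hzZ' j) (hij ▸ hyY' i)
  have h1YZ : Disjoint Ω₁ (Y ∪ Z) :=
    Finset.disjoint_union_right.mpr ⟨Finset.disjoint_of_subset_right hYP h1P, h1Z⟩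
  have h2YZ : Disjoint Ω₂ (Y ∪ Z) :=
    Finset.disjoint_union_right.mpr ⟨Finset.disjoint_of_subset_right hYP h2P, h2Z⟩
  have h1Gr : Disjoint Ω₁ Gr := Finset.disjoint_of_subset_right hGrP' h1P
  have h2Gr : Disjoint Ω₂ Gr := Finset.disjoint_of_subset_right hGrP' h2P
  have hGrYZ : Disjoint Gr (Y ∪ Z) := Finset.disjoint_union_right.mpr
    ⟨hGrY, (Finset.disjoint_of_subset_right hGrP' hZP).symm⟩
  have ha1 : 1 ≤ a := by omega
  have hωκ' : 8 * (((Δ + 1 : ℕ) : ℝ) * (2 * a + 1 : ℕ)) * κ ^ 2 < ω ^ 2 := by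
    push_cast; exact hωκ
  have hωZκ' : 8 * (((Δ + 1 : ℕ) : ℝ) * (2 * a + 1 : ℕ)) * κ ^ 2 < ωZ ^ 2 := by
    push_cast; exact hωZκ
  have hE₂' : ∀ w, #{e : E | e.1.2 = w} ≤ Δ := fun w =>
    (Finset.card_filter_coe_le fun e : Fin M × (Fin m ⊕ Fin m) => e.2 = w).trans
      (hE₂ w)
  have hE₁' : ∀ x, #{e : E | e.1.1 = x} ≤ Δ := fun x =>
    (Finset.card_filter_coe_le fun e : Fin M × (Fin m ⊕ Fin m) => e.1 = x).trans
      (hE₁ x)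
  -- the paths attached to the ports
  obtain ⟨C, hC, hCd⟩ := h.exists_disjointChoice (ι := E) (r := 2 * a + 1) (Δ := Δ + 1) (by
      refine le_trans ?_ hω
      rw [Fintype.card_coe]
      have : #E ≤ #E * a := Nat.le_mul_of_pos_right _ ha1
      have : (#E : ℝ) ≤ #E * a := by exact_mod_cast this
      push_cast
      gcongr) hωκ' hd₁
    (fun e => {port e.1.2}) (fun v => by
      simp only [Finset.mem_singleton]
      exact (Finset.card_filter_comp_le hportinj hE₂' v).trans (by omega))
    (fun e F => #F = a ∧ IsCycleSet G (insert (port e.1.2) F)) (by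
      intro e Ω' hΩ' hc hd
      have hnot : port e.1.2 ∉ Ω' := fun hmem =>
        Finset.disjoint_left.mp h1YZ (hΩ' hmem) (hportmem _)
      obtain ⟨P, hP, hPc, hPcyc⟩ := h.exists_cycle ha haL hc hnot (hd _ (by simp))
      exact ⟨P, hP, by omega, by omega, hPcyc⟩)
  have hcex : ∀ e, ∃ c : Fin a → V, Function.Injective c ∧ univ.image c = C e := fun e =>
    Finset.exists_enumeration (by simpa using (hC e).2.1)
  choose c hc hcC using hcex
  have hcC' : ∀ e i, c e i ∈ C e := fun e i => by rw [← hcC]; simp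
  have hcinj : Function.Injective fun q : E × Fin a => c q.1 q.2 := by
    rintro ⟨e, i⟩ ⟨e', i'⟩ hee
    dsimp only at hee
    have : e = e' := by
      by_contra hne
      exact Finset.disjoint_left.mp (hCd e e' hne) (hcC' e i) (hee ▸ hcC' e' i')
    subst this
    rw [hc e hee]
  -- the switchers
  obtain ⟨S, hS, hSd⟩ := h.exists_disjointChoice (ι := E × Fin a) (r := 2 * a + 1) (Δ := Δ + 1) (by
      refine le_trans (le_of_eq ?_) hω
      simp) hωκ' hd₂
    (fun q => {c q.1 q.2, g (q.1.1.1, q.2)}) (fun v => by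
      simp only [Finset.mem_insert, Finset.mem_singleton]
      rw [Finset.filter_or, add_comm]
      refine (Finset.card_union_le _ _).trans (add_le_add (Finset.card_filter_eq_le_one hcinj v) ?_)
      refine Finset.card_filter_comp_le (g := fun q : E × Fin a => (q.1.1.1, q.2)) hg ?_ v
      rintro ⟨x, i⟩
      rw [← Finset.card_image_of_injOn (f := Prod.fst)]
      · refine (Finset.card_le_card ?_).trans (hE₁' x)
        intro e he
        simp only [mem_image, mem_filter, mem_univ, true_and, Prod.mk.injEq] at he ⊢
        obtain ⟨q, hq, rfl⟩ := he
        exact hq.1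
      · rintro ⟨e, j⟩ hq ⟨e', j'⟩ hq' heq
        simp only [coe_filter, mem_univ, true_and, Prod.mk.injEq, Set.mem_ofPred_eq] at hq hq'
        dsimp only at heq
        rw [heq, hq.2, hq'.2])
    (fun q F => #F = 2 * a + 1 ∧ IsTwoCycleSet G (a + 1) (insert (c q.1 q.2) F) ∧
      IsTwoCycleSet G (a + 1) (insert (g (q.1.1.1, q.2)) F)) (by
      intro q Ω' hΩ' hc hd
      obtain ⟨F, hF, hFc, hF1, hF2⟩ := h.exists_switcher ha haL hc
        (u := c q.1 q.2) (v := g (q.1.1.1, q.2))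
        (fun hmem => Finset.disjoint_left.mp h12 ((hC _).1 (hcC' _ _)) (hΩ' hmem))
        (fun hmem => Finset.disjoint_left.mp h2Gr (hΩ' hmem) (hgG' _))
        (hd _ (by simp)) (hd _ (by simp))
      exact ⟨F, hF, by omega, by omega, hF1, hF2⟩)
  set A := univ.image g ∪ univ.biUnion C ∪ univ.biUnion S with hA
  have hAc : #A ≤ M * a + #E * a + #E * a * (2 * a + 1) := by
    refine (Finset.card_union_le _ _).trans (add_le_add ((Finset.card_union_le _ _).trans
      (add_le_add ?_ ?_)) ?_)
    · rw [hgG, hGrm]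
    · simpa using Finset.card_biUnion_le_card_mul univ C a fun e _ => (hC e).2.1.le
    · simpa using Finset.card_biUnion_le_card_mul univ S (2 * a + 1) fun e _ => (hS e).2.1.le
  have hAYZ : Disjoint A (Y ∪ Z) := by
    rw [hA, hgG, Finset.disjoint_union_left, Finset.disjoint_union_left,
      Finset.disjoint_biUnion_left, Finset.disjoint_biUnion_left]
    exact ⟨⟨hGrYZ, fun e _ => Finset.disjoint_of_subset_left (hC e).1 h1YZ⟩,
      fun q _ => Finset.disjoint_of_subset_left (hS q).1 h2YZ⟩
  -- greedy packing outside of the absorber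
  have hrest : M'.sum + u ≤ #(univ \ (A ∪ (Y ∪ Z))) := by
    rw [Finset.card_univ_sdiff]
    have h1 := Finset.card_union_le A (Y ∪ Z)
    have h2 := Finset.card_union_le Y Z
    have h3 : (M + 2 * (#E * a) + u) * (a + 1) =
      (M + a * u) + M * a + #E * a + #E * a * (2 * a + 1) + u := by ring
    omega
  obtain ⟨T, hT, hTc, hTM⟩ := HasCycles.exists_greedy (G := G) (K := u) (L := L)
    (fun ℓ h4 hL U hUu => hU.exists_cycle_subset h4 hL (hu.trans (by exact_mod_cast hUu)))
    (univ \ (A ∪ (Y ∪ Z))) M' hM' hrest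
  obtain ⟨U, hUT, hUc⟩ := Finset.exists_subset_card_eq (s := (univ \ (A ∪ (Y ∪ Z))) \ T) (n := u)
    (by rw [Finset.card_sdiff_of_subset hT]; omega)
  have hUA : Disjoint U (A ∪ (Y ∪ Z)) :=
    Finset.disjoint_of_subset_left (hUT.trans Finset.sdiff_subset) Finset.sdiff_disjoint
  have hUT' : Disjoint U T := Finset.disjoint_of_subset_left hUT Finset.sdiff_disjoint
  have hUZ : Disjoint U Z := Finset.disjoint_of_subset_right
    (subset_union_right.trans subset_union_right) hUA
  have hTA : Disjoint T (A ∪ (Y ∪ Z)) := Finset.disjoint_of_subset_left hT Finset.sdiff_disjoint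
  have hTZ : Disjoint T Z := Finset.disjoint_of_subset_right
    (subset_union_right.trans subset_union_right) hTA
  -- covering the leftover vertices
  obtain ⟨D, hD, hDd⟩ := hZ.exists_disjointChoice (ι := U) (r := 2 * a + 1) (Δ := Δ + 1) (by
      refine le_trans (le_of_eq ?_) hωZ
      simp [hUc]) hωZκ' hdZ
    (fun v => {v.1}) (fun v => by
      simp only [Finset.mem_singleton]
      exact (Finset.card_filter_eq_le_one Subtype.val_injective v).trans (by omega))
    (fun v F => #F = a ∧ IsCycleSet G (insert v.1 F)) (by
      intro v Ω' hΩ' hc hd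
      obtain ⟨P, hP, hPc, hPcyc⟩ := hZ.exists_cycle ha haL hc
        (fun hmem => Finset.disjoint_left.mp hUZ v.2 (hΩ' hmem)) (hd _ (by simp))
      exact ⟨P, hP, by omega, by omega, hPcyc⟩)
  set W := univ.biUnion D with hW
  have hWZ : W ⊆ Z := by
    rw [hW, Finset.biUnion_subset]
    exact fun v _ => (hD v).1
  have hWc : #W = a * u := by
    rw [hW, Finset.card_biUnion fun v _ v' _ hvv => hDd v v' hvv,
      Finset.sum_congr rfl fun v _ => (hD v).2.1]
    simp [hUc, mul_comm]
  have hUD : HasCycles G (Multiset.replicate u (a + 1)) (U ∪ W) := by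
    have h1 := HasCycles.biUnion (G := G) (univ : Finset U) (M := {a + 1})
      (S := fun v => insert v.1 (D v)) (fun v _ => HasCycles.singleton (hD v).2.2 (by
        rw [Finset.card_insert_of_notMem, (hD v).2.1]
        exact fun hmem => Finset.disjoint_left.mp hUZ v.2 ((hD v).1 hmem))) (by
        intro v _ v' _ hvv
        rw [Finset.disjoint_insert_left, Finset.disjoint_insert_right, Finset.mem_insert, not_or]
        exact ⟨⟨fun he => hvv (Subtype.ext he),
          fun hmem => Finset.disjoint_left.mp hUZ v.2 ((hD v').1 hmem)⟩,
          fun hmem => Finset.disjoint_left.mp hUZ v'.2 ((hD v).1 hmem), hDd v v' hvv⟩)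
    rw [Finset.card_univ, Fintype.card_coe, hUc, Multiset.nsmul_singleton] at h1
    refine h1.mono ?_
    intro x hx
    simp only [hW, mem_biUnion, mem_univ, true_and, mem_insert, mem_union] at hx ⊢
    obtain ⟨v, rfl | hx⟩ := hx
    · exact Or.inl v.2
    · exact Or.inr ⟨v, hx⟩
  set R : Finset (Fin m) := {i | z i ∈ W} with hR
  have hRc : #R = a * u := by
    rw [← hWc, ← Finset.card_image_of_injective R hz]
    congr 1
    ext v
    simp only [hR, mem_image, mem_filter, mem_univ, true_and]
    constructor
    · rintro ⟨i, hi, rfl⟩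
      exact hi
    · intro hv
      have hvZ := hWZ hv
      rw [← hzZ, Finset.mem_image] at hvZ
      obtain ⟨i, -, rfl⟩ := hvZ
      exact ⟨i, hv, rfl⟩
  obtain ⟨f, hf, hfE⟩ := hE R hRc
  have habs := HasCycles.absorber (G := G) (port := port) (g := g) (C := C) (c := c) (S := S)
    (fun v => if v ∈ Ω₁ then 2 else if v ∈ Ω₂ then 3 else if v ∈ Y ∪ Z then 0 else 1)
    hportinj hg hc hcC' hCd hSd (fun e => (hC e).2) (fun q => (hS q).2.2)
    (fun w => by
      rw [if_neg (Finset.disjoint_right.mp h1YZ (hportmem w)),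
        if_neg (Finset.disjoint_right.mp h2YZ (hportmem w)), if_pos (hportmem w)])
    (fun q => by
      rw [if_neg (Finset.disjoint_right.mp h1Gr (hgG' q)),
        if_neg (Finset.disjoint_right.mp h2Gr (hgG' q)),
        if_neg (Finset.disjoint_left.mp hGrYZ (hgG' q))])
    (fun e v hv => by rw [if_pos ((hC e).1 hv)])
    (fun q v hv => by
      rw [if_neg (Finset.disjoint_right.mp h12 ((hS q).1 hv)), if_pos ((hS q).1 hv)])
    hf (fun x => (hfE x).1)
  rw [← hA] at habs
  have hfYZ : univ.image (fun x => port (f x)) ⊆ Y ∪ Z := by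
    intro v hv
    obtain ⟨x, -, rfl⟩ := Finset.mem_image.mp hv
    exact hportmem _
  have hfW : Disjoint (univ.image (fun x => port (f x))) W := by
    rw [Finset.disjoint_left]
    intro v hv hvW
    obtain ⟨x, -, rfl⟩ := Finset.mem_image.mp hv
    have hx := (hfE x).2
    rcases hfx : f x with i | i
    · rw [hfx] at hvW
      exact Finset.disjoint_left.mp hZY (hWZ hvW) (hyY' i)
    · rw [hfx] at hvW
      exact hx i (by rw [hR, Finset.mem_filter]; exact ⟨Finset.mem_univ _, hvW⟩) hfx
  have hAW : Disjoint A W := Finset.disjoint_of_subset_right (hWZ.trans subset_union_right) hAYZ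
  have hfU : Disjoint (univ.image fun x => port (f x)) U :=
    (Finset.disjoint_of_subset_right (hfYZ.trans subset_union_right) hUA).symm
  have hAU : Disjoint A U := (Finset.disjoint_of_subset_right subset_union_left hUA).symm
  have hTA' : Disjoint T A := Finset.disjoint_of_subset_right subset_union_left hTA
  have hTf : Disjoint T (univ.image fun x => port (f x)) :=
    Finset.disjoint_of_subset_right (hfYZ.trans subset_union_right) hTA
  have hTW : Disjoint T W := Finset.disjoint_of_subset_right hWZ hTZ
  clear_value A W
  have hfUW : Disjoint (univ.image (fun x => port (f x)) ∪ A) (U ∪ W) := by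
    simp only [Finset.disjoint_union_left, Finset.disjoint_union_right]
    exact ⟨⟨hfU, hAU⟩, hfW, hAW⟩
  have hTall : Disjoint T (univ.image (fun x => port (f x)) ∪ A ∪ (U ∪ W)) := by
    simp only [Finset.disjoint_union_right]
    exact ⟨⟨hTf, hTA'⟩, hUT'.symm, hTW⟩
  have htot := hTM.add (habs.add hUD hfUW) hTall
  rw [← Multiset.replicate_add] at htot
  exact htot.mono (Finset.subset_univ _)

section

variable {V : Type} [Fintype V] [DecidableEq V] {G : SimpleGraph V} [DecidableRel G.Adj]

theorem CycleScale.of_le {p ε η n : ℝ} {L : ℕ} (hL : 1 ≤ L) (hp : 0 < p) (hp2 : p ≤ 1 / 2)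
    (hn : 0 < n) (hη : 0 < η) (hε : 0 < ε) (hεη : 32 * L * ε ≤ η)
    (hpn : 16 * (L + 1) ≤ η * (p ^ 2 * n)) (hG : Bijumbled G p (p * (ε * p * n))) :
    CycleScale G p (ε * p * n) (η * n) ⌊η * n / (4 * L)⌋₊ L := by
  have hL' : (1 : ℝ) ≤ L := by exact_mod_cast hL
  have hηn : 0 < η * n := by positivity
  have hpq : 4 * (p ^ 2 * n) ≤ n := by nlinarith [mul_pos hp hn]
  have hlarge : 64 * (L + 1) ≤ η * n := by nlinarith
  set B := η * n / (4 * L) with hB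
  have hBL : 4 * L * B = η * n := by rw [hB]; field_simp
  have hB2 : 2 ≤ B := by
    rw [hB, le_div_iff₀ (by positivity)]
    linarith
  have hb : (⌊B⌋₊ : ℝ) ≤ B := Nat.floor_le (by linarith)
  have hb' : B / 2 ≤ ⌊B⌋₊ := by linarith [Nat.lt_floor_add_one B]
  have hεB : 8 * (ε * n) ≤ B := by
    rw [hB, le_div_iff₀ (by positivity)]
    nlinarith
  have hε2 : 1024 * ε ^ 2 * L ≤ η ^ 2 := by
    have h1 : (32 * L * ε) ^ 2 ≤ η ^ 2 := by gcongr
    have h2 : 1024 * ε ^ 2 * L * 1 ≤ 1024 * ε ^ 2 * L * L := by gcongr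
    linarith
  have hε3 : 1024 * ε ^ 2 ≤ η ^ 2 := by nlinarith [sq_nonneg ε]
  refine ⟨hp, hp2, by positivity, hG, ?_, ?_, ?_, ?_, ?_⟩
  · have : ε * p * n ≤ ε * (1 / 2) * n := by gcongr
    nlinarith [mul_pos hε hn]
  · nlinarith
  · have hf : η * (p ^ 2 * n) / 4 ≤ p * (p * (η * n)) / 2 - L - 1 := by
      have : p * (p * (η * n)) = η * (p ^ 2 * n) := by ring
      rw [this]
      linarith
    refine le_trans ?_ (mul_le_mul hf hb' (by positivity) (le_trans (by positivity) hf))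
    have h1 : 16 * (ε * p * n) ^ 2 * L ≤ η * (p ^ 2 * n) / 4 * (B / 2) * L := by
      have h2 : η * (p ^ 2 * n) / 4 * (B / 2) * L = η * (p ^ 2 * n) / 32 * (4 * L * B) := by ring
      rw [h2, hBL]
      have h3 : 16 * (ε * p * n) ^ 2 * L = (1024 * ε ^ 2 * L) * (p * n) ^ 2 / 64 := by ring
      have h4 : η * (p ^ 2 * n) / 32 * (η * n) = η ^ 2 * (p * n) ^ 2 / 32 := by ring
      rw [h3, h4]
      have := mul_le_mul_of_nonneg_right hε2 (sq_nonneg (p * n))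
      have := mul_nonneg (sq_nonneg η) (sq_nonneg (p * n))
      linarith
    exact le_of_mul_le_mul_right h1 (by linarith)
  · have : p * (p * (η * n)) = η * (p ^ 2 * n) := by ring
    rw [this]
    linarith
  · have h1 : 8 * (ε * p * n) ^ 2 = 8 * ε ^ 2 * p * (p * n ^ 2) := by ring
    have h2 : p * (η * n) * (η * n) = η ^ 2 * (p * n ^ 2) := by ring
    rw [h1, h2]
    refine mul_lt_mul_of_pos_right ?_ (by positivity)
    nlinarith [sq_pos_of_pos hε]

/-- Splitting the vertex set so that degrees are split proportionally. -/
theorem SimpleGraph.exists_degree_partition [Nonempty V] {h : ℕ} (hh : 0 < h) {d : ℝ}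
    (hd : ∀ v, d ≤ G.degree v)
    (hlarge : Fintype.card V * (3 * h : ℕ) * Real.exp (-(d / (4 * (3 * h : ℕ)))) < 1) :
    ∃ Ω₁ Ω₂ Z Pool : Finset V, Disjoint Ω₁ Ω₂ ∧ Disjoint Ω₁ Z ∧ Disjoint Ω₂ Z ∧
      Disjoint Ω₁ Pool ∧ Disjoint Ω₂ Pool ∧ Disjoint Z Pool ∧ #Z * h ≤ Fintype.card V ∧
      #Z * h ≤ #Pool + #Z ∧ (∀ v, d / 12 ≤ #{u ∈ Ω₁ | G.Adj v u}) ∧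
      (∀ v, d / 12 ≤ #{u ∈ Ω₂ | G.Adj v u}) ∧ ∀ v, d / (12 * h) ≤ #{u ∈ Z | G.Adj v u} := by
  have hh' : (0 : ℝ) < h := by exact_mod_cast hh
  obtain ⟨f, hf⟩ := exists_balanced_coloring (by omega : 0 < 3 * h)
    (fun v => ({u | G.Adj v u} : Finset V))
    (fun v => by rw [← G.neighborFinset_eq_filter, G.card_neighborFinset_eq_degree]; exact hd v)
    hlarge
  set c : V → Fin 3 × Fin h := fun v => finProdFinEquiv.symm (f v) with hc
  have hcf : ∀ v q, d / (12 * h) ≤ (#{u | G.Adj v u ∧ c u = q} : ℝ) := by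
    intro v q
    have h1 := hf v (finProdFinEquiv q)
    rw [Finset.filter_filter] at h1
    have h2 : d / (4 * (3 * h : ℕ)) = d / (12 * h) := by
      push_cast
      ring
    rw [h2] at h1
    simpa only [hc, Equiv.symm_apply_eq] using h1
  have hgroup : ∀ i v, d / 12 ≤ (#{u ∈ ({u | (c u).1 = i} : Finset V) | G.Adj v u} : ℝ) := by
    intro i v
    rw [Finset.card_eq_sum_card_fiberwise (f := fun u => (c u).2) (t := univ) (by simp)]
    push_cast
    refine le_trans ?_ (Finset.card_nsmul_le_sum univ _ (d / (12 * h)) fun j _ => ?_)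
    · rw [Finset.card_univ, Fintype.card_fin, nsmul_eq_mul]
      refine le_of_eq ?_
      field_simp
    · refine (hcf v (i, j)).trans (le_of_eq ?_)
      congr 2
      ext u
      simp only [mem_filter, mem_univ, true_and, Prod.ext_iff]
      tauto
  obtain ⟨j, -, hj⟩ := Finset.exists_min_image (univ : Finset (Fin h))
    (fun j => #{u | c u = (2, j)}) ⟨⟨0, hh⟩, mem_univ _⟩
  have hsum : #{u | c u = (2, j)} * h ≤ #{u | (c u).1 = 2} := by
    rw [Finset.card_eq_sum_card_fiberwise (f := fun u => (c u).2) (t := univ)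
      (s := {u | (c u).1 = 2}) (by simp)]
    refine le_trans ?_ (Finset.card_nsmul_le_sum univ _ #{u | c u = (2, j)} fun i hi => ?_)
    · rw [Finset.card_univ, Fintype.card_fin, smul_eq_mul, mul_comm]
    · refine (hj i hi).trans (le_of_eq ?_)
      congr 1
      ext u
      simp only [mem_filter, mem_univ, true_and, Prod.ext_iff]
  refine ⟨({u | (c u).1 = 0} : Finset V), ({u | (c u).1 = 1} : Finset V),
    ({u | c u = (2, j)} : Finset V), ({u | (c u).1 = 2 ∧ (c u).2 ≠ j} : Finset V),
    ?_, ?_, ?_, ?_, ?_, ?_, hsum.trans (Finset.card_le_univ _), ?_, hgroup 0, hgroup 1, ?_⟩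
  · exact Finset.disjoint_filter.mpr fun u _ h1 h2 => by simp [h1] at h2
  · exact Finset.disjoint_filter.mpr fun u _ h1 h2 => by simp [h2] at h1
  · exact Finset.disjoint_filter.mpr fun u _ h1 h2 => by simp [h2] at h1
  · exact Finset.disjoint_filter.mpr fun u _ h1 h2 => by simp [h1] at h2
  · exact Finset.disjoint_filter.mpr fun u _ h1 h2 => by simp [h1] at h2
  · exact Finset.disjoint_filter.mpr fun u _ h1 h2 => by simp [h1] at h2
  · refine hsum.trans ((Finset.card_le_card ?_).trans (Finset.card_union_le _ _))
    intro u hu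
    simp only [mem_filter, mem_univ, true_and, mem_union, Prod.ext_iff] at hu ⊢
    tauto
  · intro v
    refine (hcf v (2, j)).trans (le_of_eq ?_)
    congr 2
    ext u
    simp only [mem_filter, mem_univ, true_and]
    tauto

end

theorem Multiset.exists_sum_le_count {L : ℕ} (hL : 4 ≤ L) {M : Multiset ℕ}
    (hM : ∀ ℓ ∈ M, 4 ≤ ℓ ∧ ℓ ≤ L) : ∃ ℓ, 4 ≤ ℓ ∧ ℓ ≤ L ∧ M.sum ≤ L * L * M.count ℓ := by
  obtain ⟨ℓ, hℓ, hmax⟩ := Finset.exists_max_image (Finset.Icc 4 L) (fun ℓ => M.count ℓ)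
    ⟨L, by simp [hL]⟩
  rw [Finset.mem_Icc] at hℓ
  refine ⟨ℓ, hℓ.1, hℓ.2, ?_⟩
  have hsub : M.toFinset ⊆ Finset.Icc 4 L := fun x hx => by
    rw [Finset.mem_Icc]
    exact hM x (Multiset.mem_toFinset.mp hx)
  rw [Finset.sum_multiset_count_of_subset M _ hsub]
  refine (Finset.sum_le_card_nsmul _ _ (M.count ℓ * L) fun x hx => ?_).trans ?_
  · rw [smul_eq_mul]
    exact Nat.mul_le_mul (hmax x hx) (Finset.mem_Icc.mp hx).2
  · rw [Nat.card_Icc, smul_eq_mul, mul_comm (M.count ℓ), ← mul_assoc]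
    gcongr
    omega

/-- The maximum degree of the templates of `exists_template`. -/
noncomputable def templateDegree : ℕ := exists_template.choose

set_option maxHeartbeats 1000000 in
theorem hasCycles_of_partition {V : Type} [Fintype V] [DecidableEq V] [Nonempty V]
    {G : SimpleGraph V} [DecidableRel G.Adj] {p ε η : ℝ} {L h n : ℕ} (hV : Fintype.card V = n)
    (hL : 4 ≤ L) (hp : 0 < p) (hp2 : p ≤ 1 / 2) (hη : 0 < η) (hε : 0 < ε)
    (hεη : 1024 * L ^ 2 * (templateDegree + 1) * ε ≤ η)
    (hpn : 512 * L * (L + 1) ≤ η * (p ^ 2 * n)) (hh : 14 * (templateDegree + 1) * L ^ 3 ≤ h)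
    (hhη : 16 * templateDegree * L ^ 2 ≤ h * (h * η)) (hG : Bijumbled G p (p * (ε * p * n)))
    {Ω₁ Ω₂ Z Pool : Finset V} (h12 : Disjoint Ω₁ Ω₂) (h1Z : Disjoint Ω₁ Z) (h2Z : Disjoint Ω₂ Z)
    (h1P : Disjoint Ω₁ Pool) (h2P : Disjoint Ω₂ Pool) (hZP : Disjoint Z Pool)
    (hZn : #Z * h ≤ n) (hZPool : #Z * h ≤ #Pool + #Z)
    (hd₁ : ∀ v, p * (2 * (h * η * n)) ≤ #{u ∈ Ω₁ | G.Adj v u})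
    (hd₂ : ∀ v, p * (2 * (h * η * n)) ≤ #{u ∈ Ω₂ | G.Adj v u})
    (hdZ : ∀ v, p * (2 * (η * n)) ≤ #{u ∈ Z | G.Adj v u})
    (N : Multiset ℕ) (hN : ∀ ℓ ∈ N, 4 ≤ ℓ ∧ ℓ ≤ L) (hNn : N.sum ≤ n) (hnN : n ≤ N.sum + 3) :
    HasCycles G N univ := by
  obtain ⟨ℓ, hℓ4, hℓL, hcount⟩ := Multiset.exists_sum_le_count hL hN
  obtain ⟨a, rfl⟩ : ∃ a, ℓ = a + 1 := ⟨ℓ - 1, by omega⟩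
  set Δ := templateDegree with hΔ
  set m := #Z with hm
  have hL' : (4 : ℝ) ≤ L := by exact_mod_cast hL
  have hn : 0 < n := hV ▸ Fintype.card_pos
  have hn' : (0 : ℝ) < n := by exact_mod_cast hn
  have haL' : (a : ℝ) + 1 ≤ L := by exact_mod_cast hℓL
  have ha0 : (0 : ℝ) ≤ a := by positivity
  have hΔ0 : (0 : ℝ) ≤ Δ := by positivity
  have hhL : 14 * L ^ 3 ≤ h := (Nat.mul_le_mul_right _ (by omega)).trans hh
  have hL3 : 16 * L ≤ L ^ 3 := by nlinarith only [Nat.mul_le_mul_right L (Nat.mul_le_mul hL hL)]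
  have hh0 : 0 < h := by omega
  have hh1 : (1 : ℝ) ≤ h := by exact_mod_cast hh0
  have hpq : 4 * (p ^ 2 * n) ≤ n := by nlinarith only [mul_pos hp hn', hp2, hn', hp]
  have hηn : 2048 * L * (L + 1) ≤ η * n := by linarith only [hpn, mul_le_mul_of_nonneg_left hpq hη.le]
  have hεη' : 1024 * L ^ 2 * ε ≤ η := by
    refine le_trans ?_ hεη
    have : 0 ≤ 1024 * (L : ℝ) ^ 2 * ε := by positivity
    nlinarith only [mul_nonneg this hΔ0]
  have hκ : ε * p * n ≤ η * n / 2 := by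
    have h0 : (1 : ℝ) ≤ 1024 * L ^ 2 := by nlinarith only [hL']
    have h1 : ε ≤ η := (le_mul_of_one_le_left hε.le h0).trans hεη'
    have h2 : ε * p ≤ η * (1 / 2) := by gcongr
    linarith only [mul_le_mul_of_nonneg_right h2 hn'.le]
  have hκpos : 0 < ε * p * n := by positivity
  have hmω : η * n ≤ m := by
    have := hG.le_card hp hκpos (by positivity) hdZ
    linarith
  set u := ⌊η * n / (8 * L)⌋₊ with hu
  have hu1 : (u : ℝ) ≤ η * n / (8 * L) := Nat.floor_le (by positivity)
  have hu2 : η * n / (8 * L) < u + 1 := Nat.lt_floor_add_one _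
  rw [le_div_iff₀ (by positivity)] at hu1
  rw [div_lt_iff₀ (by positivity)] at hu2
  have hu0 : (0 : ℝ) ≤ u := by positivity
  have haum : a * u ≤ m := by
    have : (a * u : ℝ) ≤ m := by nlinarith only [hu0, hu1, haL', hmω, mul_le_mul_of_nonneg_right haL' hu0, hL']
    exact_mod_cast this
  obtain ⟨M, hM⟩ : ∃ M, M + a * u = m + m := ⟨m + m - a * u, by omega⟩
  obtain ⟨E, hE₂, hE₁, hE⟩ := exists_template.choose_spec m (a * u) M haum hM
  have hEc : #E ≤ 2 * Δ * m := by
    have h1 : #E ≤ M * Δ := by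
      have := Finset.card_le_mul_card_image_of_maps_to (f := Prod.fst) (s := E) (t := univ)
        (by simp) Δ (fun x _ => hE₁ x)
      simpa [mul_comm] using this
    refine h1.trans ?_
    have : M ≤ 2 * m := by omega
    calc M * Δ ≤ 2 * m * Δ := Nat.mul_le_mul_right _ this
      _ = _ := by ring
  have hEc' : (#E : ℝ) ≤ 2 * Δ * m := by exact_mod_cast hEc
  have hZn' : (m : ℝ) * h ≤ n := by exact_mod_cast hZn
  have hηh : η ≤ h * η := le_mul_of_one_le_left hη.le hh1
  have hεZ : 32 * L * ε ≤ η := by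
    refine le_trans ?_ hεη'
    gcongr
    · norm_num
    · exact le_self_pow₀ (by linarith only [hL']) two_ne_zero
  have hpn1 : 16 * ((L : ℝ) + 1) ≤ η * (p ^ 2 * n) := by nlinarith only [hpn, hL']
  have hpn2 : 16 * ((L : ℝ) + 1) ≤ h * η * (p ^ 2 * n) :=
    hpn1.trans (mul_le_mul_of_nonneg_right hηh (by positivity))
  have hscale := CycleScale.of_le (G := G) (L := L) (by omega) hp hp2 hn'
    (show 0 < h * η by positivity) hε (hεZ.trans hηh) hpn2 hG
  have hscaleZ := CycleScale.of_le (G := G) (L := L) (by omega) hp hp2 hn' hη hε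
    hεZ hpn1 hG
  have hscaleU := CycleScale.of_le (G := G) (L := L) (by omega) hp hp2 hn'
    (show 0 < η / (32 * L) by positivity) hε
    (by rw [le_div_iff₀ (by positivity)]; linarith)
    (by rw [div_mul_eq_mul_div, le_div_iff₀ (by positivity)]; linarith) hG
  have hm0 : (0 : ℝ) ≤ m := by positivity
  have hω : 4 * ((2 * (a : ℝ) + 1) * (#E * a)) ≤ h * η * n := by
    have h1 : 4 * ((2 * (a : ℝ) + 1) * (#E * a)) ≤ 4 * ((2 * L) * ((2 * Δ * m) * L)) := by
      gcongr <;> linarith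
    have h2 : 4 * ((2 * L) * ((2 * Δ * m) * L)) = (16 * Δ * L ^ 2) * (m : ℝ) := by ring
    have h3 : (16 * Δ * L ^ 2) * (m : ℝ) ≤ (h * (h * η)) * m := by gcongr
    have h4 : (h * (h * η)) * m = h * η * (m * h) := by ring
    have h5 : h * η * (m * h) ≤ h * η * n := by gcongr
    linarith
  have hωZ : 4 * ((2 * (a : ℝ) + 1) * u) ≤ η * n := by
    nlinarith only [hu0, hu1, haL', mul_le_mul_of_nonneg_right haL' hu0]
  have hωZκ : 8 * (((Δ : ℝ) + 1) * (2 * a + 1)) * (ε * p * n) ^ 2 < (η * n) ^ 2 := by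
    have h1 : 8 * (((Δ : ℝ) + 1) * (2 * a + 1)) ≤ 16 * ((Δ + 1) * L ^ 2) ^ 2 := by
      have h2 : ((Δ : ℝ) + 1) * (2 * a + 1) ≤ (Δ + 1) * (2 * L ^ 2) := by
        gcongr
        nlinarith only [haL', hL']
      have h3 : (1 : ℝ) ≤ (Δ + 1) * L ^ 2 :=
        one_le_mul_of_one_le_of_one_le (by linarith only [hΔ0]) (by nlinarith only [hL'])
      nlinarith only [h2, h3]
    have h4 : (1024 * L ^ 2 * (Δ + 1) * ε) ^ 2 ≤ η ^ 2 := by gcongr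
    have h5 : (ε * p * n) ^ 2 ≤ ε ^ 2 * n ^ 2 := by
      rw [mul_pow, mul_pow]
      have : p ^ 2 ≤ 1 := by nlinarith only [hp, hp2]
      have : ε ^ 2 * p ^ 2 ≤ ε ^ 2 * 1 := by gcongr
      nlinarith only [this, sq_nonneg (n : ℝ), mul_le_mul_of_nonneg_right this (sq_nonneg (n : ℝ))]
    calc 8 * (((Δ : ℝ) + 1) * (2 * a + 1)) * (ε * p * n) ^ 2
        ≤ 16 * ((Δ + 1) * L ^ 2) ^ 2 * (ε ^ 2 * n ^ 2) := by gcongr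
      _ < 1024 ^ 2 * ((Δ + 1) * L ^ 2) ^ 2 * (ε ^ 2 * n ^ 2) := by gcongr; norm_num
      _ = (1024 * L ^ 2 * (Δ + 1) * ε) ^ 2 * n ^ 2 := by ring
      _ ≤ η ^ 2 * n ^ 2 := by gcongr
      _ = (η * n) ^ 2 := by ring
  have hωκ : 8 * (((Δ : ℝ) + 1) * (2 * a + 1)) * (ε * p * n) ^ 2 < (h * η * n) ^ 2 := by
    refine hωZκ.trans_le ?_
    have : η * n ≤ h * η * n := mul_le_mul_of_nonneg_right hηh hn'.le
    gcongr
  have huU : 2 * (η / (32 * L) * n) + 1 ≤ u := by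
    have h1 : 2 * (η / (32 * L) * n) = η * n / (16 * L) := by field_simp; norm_num
    have h2 : η * n / (16 * L) ≤ u - 1 := by
      rw [div_le_iff₀ (by positivity)]
      nlinarith only [hu0, hu2, hL', hηn]
    linarith
  have hPool : m + M * a ≤ #Pool := by
    have h1 : M * a ≤ 2 * m * L := Nat.mul_le_mul (by omega) (by omega)
    have h2 : m * (2 * L + 2) ≤ m * h := Nat.mul_le_mul_left _ (by omega)
    nlinarith only [h1, h2, hZPool]
  set r := M + 2 * (#E * a) + u with hr
  have hum : u ≤ m := le_trans (Nat.le_mul_of_pos_left _ (by omega)) haum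
  have hrc : r ≤ N.count (a + 1) := by
    have h1 : #E * a ≤ 2 * Δ * m * L := Nat.mul_le_mul hEc (by omega)
    have h2 : r ≤ 7 * (Δ + 1) * L * m := by
      have : m ≤ m * L := Nat.le_mul_of_pos_right _ (by omega)
      nlinarith only [this, h1, hr, hM, hum, Nat.zero_le (m * L * Δ)]
    have h3 : 2 * (r * L ^ 2) ≤ n := by
      calc 2 * (r * L ^ 2) ≤ 2 * ((7 * (Δ + 1) * L * m) * L ^ 2) := by gcongr
        _ = m * (14 * (Δ + 1) * L ^ 3) := by ring
        _ ≤ m * h := by gcongr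
        _ ≤ n := hZn
    have hm1 : 1 ≤ m := by
      have : (0 : ℝ) < m := lt_of_lt_of_le (by positivity) hmω
      exact_mod_cast this
    have hn6 : 6 ≤ n := by
      have : h ≤ m * h := Nat.le_mul_of_pos_left _ hm1
      omega
    have h4 : r * L ^ 2 ≤ N.count (a + 1) * L ^ 2 := by
      have : L * L * N.count (a + 1) = N.count (a + 1) * L ^ 2 := by ring
      omega
    exact Nat.le_of_mul_le_mul_right h4 (by positivity)
  have hsub := tsub_add_cancel_of_le (Multiset.le_count_iff_replicate_le.mp hrc)
  rw [← hsub]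
  refine hscale.hasCycles_add_replicate hscaleZ hscaleU hℓ4 hℓL hM hE₂ hE₁ hE h12 h1Z h2Z h1P h2P
    hZP hm.symm hPool hd₁ hd₂ hdZ hω hωZ hωκ hωZκ huU _ (fun x hx => hN x ?_) ?_
  · exact Multiset.mem_of_le tsub_le_self hx
  · have := congrArg Multiset.sum hsub
    rw [Multiset.sum_add, Multiset.sum_replicate, smul_eq_mul] at this
    rw [hV]
    exact this.trans_le hNn

theorem exists_forall_mul_exp_neg_sqrt_lt (k : ℕ) {c : ℝ} (hc : 0 < c) :
    ∃ n₀ : ℕ, ∀ n ≥ n₀, (n : ℝ) * k * Real.exp (-(c * √n)) < 1 := by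
  have h1 : Filter.Tendsto (fun n : ℕ => c * √(n : ℝ)) Filter.atTop Filter.atTop :=
    (Real.tendsto_sqrt_atTop.comp tendsto_natCast_atTop_atTop).const_mul_atTop hc
  have h2 := ((Real.tendsto_pow_mul_exp_neg_atTop_nhds_zero 2).comp h1).const_mul (k / c ^ 2)
  rw [mul_zero] at h2
  obtain ⟨n₀, hn₀⟩ := Filter.eventually_atTop.mp (h2.eventually (gt_mem_nhds zero_lt_one))
  refine ⟨n₀, fun n hn => lt_of_eq_of_lt ?_ (hn₀ n hn)⟩
  have h3 : √(n : ℝ) ^ 2 = n := Real.sq_sqrt n.cast_nonneg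
  simp only [Function.comp_apply]
  rw [mul_pow, h3]
  field_simp

/-- Packings of short cycles covering all but at most three vertices. -/
theorem exists_hasCycles {δ : ℝ} (hδ : 0 < δ) {L : ℕ} (hL : 4 ≤ L) :
    ∃ ε₀ : ℝ, 0 < ε₀ ∧ ∃ n₀ : ℕ, ∀ ε : ℝ, 0 < ε → ε < ε₀ →
    ∀ (V : Type) [Fintype V] [DecidableEq V] (G : SimpleGraph V) [DecidableRel G.Adj]
      (n : ℕ), Fintype.card V = n → n₀ ≤ n →
      ∀ p lam : ℝ, 0 < p → p ≤ 1 / 2 → lam ≤ ε * p ^ 2 * n → Bijumbled G p lam →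
      (∀ v : V, δ * p * n ≤ (G.degree v : ℝ)) →
      ∀ N : Multiset ℕ, (∀ ℓ ∈ N, 4 ≤ ℓ ∧ ℓ ≤ L) → N.sum ≤ n → n ≤ N.sum + 3 →
      HasCycles G N univ := by
  obtain ⟨h, hh⟩ := exists_nat_ge
    ((14 * (templateDegree + 1) * L ^ 3 : ℕ) + 16 * templateDegree * L ^ 2 * (24 / δ) : ℝ)
  have hL' : (4 : ℝ) ≤ L := by exact_mod_cast hL
  have hh1 : 14 * (templateDegree + 1) * L ^ 3 ≤ h := by
    have h1 : (0 : ℝ) ≤ 16 * templateDegree * L ^ 2 * (24 / δ) := by positivity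
    have h2 : ((14 * (templateDegree + 1) * L ^ 3 : ℕ) : ℝ) ≤ h := by linarith
    exact_mod_cast h2
  have hh2 : 16 * templateDegree * L ^ 2 * (24 / δ) ≤ h := by
    have h1 : (0 : ℝ) ≤ (14 * (templateDegree + 1) * L ^ 3 : ℕ) := Nat.cast_nonneg _
    linarith
  have hh0 : 0 < h := lt_of_lt_of_le (by positivity) hh1
  have hh' : (0 : ℝ) < h := by exact_mod_cast hh0
  set η : ℝ := δ / (24 * h) with hη
  have hη0 : 0 < η := by positivity
  have hhη : h * η = δ / 24 := by rw [hη]; field_simp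
  set K : ℝ := 512 * L * (L + 1) / η + 1 with hK
  have hK0 : 0 < K := by positivity
  obtain ⟨n₀, hn₀⟩ := exists_forall_mul_exp_neg_sqrt_lt (3 * h)
    (show 0 < δ / (4 * (3 * h : ℕ)) by positivity)
  refine ⟨min (η / (1024 * L ^ 2 * (templateDegree + 1))) √(δ / (2 * K)), by positivity,
    max n₀ 1, fun ε hε hεlt V _ _ G _ n hV hn p lam hp hp2 hlam hG hdeg N hN hNn hnN => ?_⟩
  have hε1 := hεlt.le.trans (min_le_left _ _)
  have hε2 := hεlt.le.trans (min_le_right _ _)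
  have hn1 : 1 ≤ n := (le_max_right _ _).trans hn
  have hn' : (0 : ℝ) < n := by exact_mod_cast hn1
  have : Nonempty V := Fintype.card_pos_iff.mp (by omega)
  have hG' := hG.mono hlam
  have hpK : K ≤ p ^ 2 * n := by
    have h1 : δ * p * n ≤ 4 * (ε * p ^ 2 * n) ^ 2 :=
      (hdeg (Classical.arbitrary V)).trans (hG'.degree_le hp2 (by positivity) _)
    have h2 : ε ^ 2 * (2 * K) ≤ δ := by
      rw [← le_div_iff₀ (by positivity)]
      exact (Real.le_sqrt hε.le (by positivity)).mp hε2
    have h3 : δ * (p * n) ≤ 4 * ε ^ 2 * p * (p ^ 2 * n) * (p * n) := by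
      calc δ * (p * n) = δ * p * n := by ring
        _ ≤ _ := h1
        _ = _ := by ring
    have h4 : δ ≤ 4 * ε ^ 2 * p * (p ^ 2 * n) := le_of_mul_le_mul_right h3 (by positivity)
    have h5 : 4 * ε ^ 2 * p * (p ^ 2 * n) ≤ 4 * ε ^ 2 * (1 / 2) * (p ^ 2 * n) := by gcongr
    have h6 : (2 * ε ^ 2) * K ≤ (2 * ε ^ 2) * (p ^ 2 * n) := by linarith
    exact le_of_mul_le_mul_left h6 (by positivity)
  have hpn : 512 * L * (L + 1) ≤ η * (p ^ 2 * n) := by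
    have h1 : 512 * L * (L + 1) / η ≤ p ^ 2 * n := by linarith
    rw [div_le_iff₀ hη0] at h1
    linarith
  have hsqrt : √(n : ℝ) ≤ p * n := by
    rw [Real.sqrt_le_left (by positivity)]
    have h1 : 1 ≤ K := le_add_of_nonneg_left (by positivity)
    have h2 : 1 ≤ p ^ 2 * n := h1.trans hpK
    calc (n : ℝ) = 1 * n := (one_mul _).symm
      _ ≤ p ^ 2 * n * n := by gcongr
      _ = _ := by ring
  obtain ⟨Ω₁, Ω₂, Z, Pool, h12, h1Z, h2Z, h1P, h2P, hZP, hZn, hZPool, hd₁, hd₂, hdZ⟩ :=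
    G.exists_degree_partition hh0 hdeg (by
      rw [hV]
      refine lt_of_le_of_lt ?_ (hn₀ n ((le_max_left _ _).trans hn))
      rw [mul_assoc δ]
      gcongr
      rw [div_mul_eq_mul_div]
      gcongr)
  rw [hV] at hZn
  have hω : p * (2 * (h * η * n)) = δ * p * n / 12 := by rw [hhη]; ring
  have hωZ : p * (2 * (η * n)) = δ * p * n / (12 * h) := by rw [hη]; field_simp; norm_num
  refine hasCycles_of_partition hV hL hp hp2 hη0 hε ?_ hpn hh1 ?_ ?_ h12 h1Z h2Z h1P h2P hZP hZn
    hZPool (fun v => hω ▸ hd₁ v) (fun v => hω ▸ hd₂ v) (fun v => hωZ ▸ hdZ v) N hN hNn hnN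
  · rw [le_div_iff₀ (by positivity)] at hε1
    linarith
  · rw [hhη]
    have h1 : 16 * templateDegree * L ^ 2 * (24 / δ) * (δ / 24) ≤ h * (δ / 24) := by gcongr
    refine le_trans (le_of_eq ?_) h1
    field_simp
  · have h1 : p * (ε * p * n) = ε * p ^ 2 * n := by ring
    rwa [h1]

/-- for every `δ > 0` and `L ∈ ℕ` there are `ε₀ > 0` and `n₀` such that for
every `0 < ε < ε₀`, every `(p,λ)`-bijumbled graph `G` on `n ≥ n₀` vertices with
`p ∈ (0,1/2]`, `λ ≤ ε p² n` and minimum degree at least `δ p n` contains any family of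
vertex-disjoint cycles with lengths in `[4,L]` whose lengths sum up to at most `n`. -/
theorem stmt3 (δ : ℝ) (hδ : 0 < δ) (L : ℕ) :
    ∃ ε₀ : ℝ, 0 < ε₀ ∧ ∃ n₀ : ℕ, ∀ ε : ℝ, 0 < ε → ε < ε₀ →
    ∀ (V : Type) [Fintype V] [DecidableEq V] (G : SimpleGraph V) [DecidableRel G.Adj]
      (n : ℕ), Fintype.card V = n → n₀ ≤ n →
      ∀ p lam : ℝ, 0 < p → p ≤ 1 / 2 → lam ≤ ε * p ^ 2 * n → Bijumbled G p lam →
      (∀ v : V, δ * p * n ≤ (G.degree v : ℝ)) →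
      ∀ (t : ℕ) (ℓ : Fin t → ℕ), (∀ i, 4 ≤ ℓ i ∧ ℓ i ≤ L) → ∑ i, ℓ i ≤ n →
      ∃ (v : Fin t → V) (c : ∀ i, G.Walk (v i) (v i)),
        (∀ i, (c i).IsCycle ∧ (c i).length = ℓ i) ∧
        (∀ i j, i ≠ j → Disjoint (c i).support.toFinset (c j).support.toFinset) := by
  obtain ⟨ε₀, hε₀, n₀, hmain⟩ := exists_hasCycles hδ (le_max_right L 4)
  refine ⟨ε₀, hε₀, n₀, fun ε hε hεlt V _ _ G _ n hV hn p lam hp hp2 hlam hG hdeg t ℓ hℓ hsum => ?_⟩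
  set ℓ' : Fin t ⊕ Fin ((n - ∑ i, ℓ i) / 4) → ℕ := Sum.elim ℓ fun _ => 4 with hℓ'
  have hsum' : (univ.val.map ℓ').sum = ∑ i, ℓ i + (n - ∑ i, ℓ i) / 4 * 4 := by
    rw [Finset.sum_map_val, Fintype.sum_sum_type]
    simp [hℓ']
  have hcyc := hmain ε hε hεlt V G n hV hn p lam hp hp2 hlam hG hdeg (univ.val.map ℓ') (by
    intro x hx
    obtain ⟨i | i, -, rfl⟩ := Multiset.mem_map.mp hx
    · exact ⟨(hℓ i).1, (hℓ i).2.trans (le_max_left _ _)⟩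
    · exact ⟨le_rfl, le_max_right _ _⟩) (by omega) (by omega)
  obtain ⟨F, hF, hFd⟩ := HasCycles.exists_indexed univ ℓ' hcyc
  choose v c hc using fun i => (hF (Sum.inl i) (mem_univ _)).1
  refine ⟨v, c, fun i => ⟨(hc i).1, ?_⟩, fun i j hij => ?_⟩
  · rw [(hc i).2.2, (hF (Sum.inl i) (mem_univ _)).2.1, hℓ', Sum.elim_inl]
  · rw [(hc i).2.1, (hc j).2.1]
    exact hFd _ (mem_univ _) _ (mem_univ _) fun h => hij (Sum.inl_injective h)
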